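/- For every integer n ≥ 2, the total number of partitions in NC^B(n-1,1) equals the central binomial coefficient C(2n, n). -/

import Mathlib

/-!  Common setup: annular non-crossing partitions of type B, following
Goulden–Nica–Oancea, "Enumerative properties of NC^(B)(p,q)". -/

/-- The underlying set `{±1, …, ±n}`, realized inside `ℤ`. -/
def signedSet (n : ℕ) : Set ℤ := {x : ℤ | x ≠ 0 ∧ |x| ≤ (n : ℤ)}

/-- Membership in the hyperoctahedral group `B_n`, realized as the permutations of `ℤ`
that commute with negation and fix every point outside `{±1, …, ±n}`. -/
def inB (n : ℕ) (π : Equiv.Perm ℤ) : Prop :=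
  (∀ x : ℤ, π (-x) = -(π x)) ∧ ∀ x : ℤ, x ∉ signedSet n → π x = x

/-- The set of generators of `B_n`:
`(i,j)(-i,-j)`, `(i,-j)(-i,j)` for `1 ≤ i ≠ j ≤ n`, and `(i,-i)` for `1 ≤ i ≤ n`. -/
def genB (n : ℕ) : Set (Equiv.Perm ℤ) :=
  {π | (∃ i j : ℤ, 1 ≤ i ∧ i ≤ (n : ℤ) ∧ 1 ≤ j ∧ j ≤ (n : ℤ) ∧ i ≠ j ∧
          π = Equiv.swap i j * Equiv.swap (-i) (-j)) ∨
       (∃ i j : ℤ, 1 ≤ i ∧ i ≤ (n : ℤ) ∧ 1 ≤ j ∧ j ≤ (n : ℤ) ∧ i ≠ j ∧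
          π = Equiv.swap i (-j) * Equiv.swap (-i) j) ∨
       (∃ i : ℤ, 1 ≤ i ∧ i ≤ (n : ℤ) ∧ π = Equiv.swap i (-i))}

/-- The length function `ℓ_B` on `B_n`: the least `k` such that `τ` is a product of `k`
generators from `genB n` (the empty product being the identity). -/
noncomputable def lenB (n : ℕ) (τ : Equiv.Perm ℤ) : ℕ :=
  sInf {k : ℕ | ∃ l : List (Equiv.Perm ℤ),
    l.length = k ∧ (∀ g ∈ l, g ∈ genB n) ∧ l.prod = τ}

/-- The partial order on `B_n`:  `τ ≤ σ` iff `ℓ_B(σ) = ℓ_B(τ) + ℓ_B(τ⁻¹σ)`. -/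
def leB (n : ℕ) (τ σ : Equiv.Perm ℤ) : Prop :=
  lenB n σ = lenB n τ + lenB n (τ⁻¹ * σ)

/-- The permutation `γ_{p,q} = (1,…,p,-1,…,-p)(p+1,…,p+q,-(p+1),…,-(p+q))`. -/
def gammaPQ (p q : ℕ) : Equiv.Perm ℤ :=
  (((List.range p).map fun i => ((i : ℤ) + 1)) ++
      ((List.range p).map fun i => -((i : ℤ) + 1))).formPerm *
    (((List.range q).map fun i => ((p : ℤ) + (i : ℤ) + 1)) ++
      ((List.range q).map fun i => -((p : ℤ) + (i : ℤ) + 1))).formPerm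

/-- The long cycle `γ_n = (1,…,n,-1,…,-n)` of `B_n` (disc case). -/
def gammaDisc (n : ℕ) : Equiv.Perm ℤ :=
  (((List.range n).map fun i => ((i : ℤ) + 1)) ++
    ((List.range n).map fun i => -((i : ℤ) + 1))).formPerm

/-- The annular non-crossing permutations of type B: `S^B_nc(p,q) = [ε, γ_{p,q}] ⊆ B_{p+q}`. -/
def SncB (p q : ℕ) : Set (Equiv.Perm ℤ) :=
  {τ | inB (p + q) τ ∧ leB (p + q) τ (gammaPQ p q)}

/-- The orbit of `x` under the permutation `τ`. -/
def permOrbit (τ : Equiv.Perm ℤ) (x : ℤ) : Set ℤ := {y | ∃ m : ℤ, (τ ^ m) x = y}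

/-- The partition `Ω(τ)` of `{±1,…,±n}` into orbits of `τ`. -/
def orbitsOn (n : ℕ) (τ : Equiv.Perm ℤ) : Set (Set ℤ) :=
  {A | ∃ x ∈ signedSet n, A = permOrbit τ x}

/-- The negation `-A` of a set `A ⊆ ℤ`. -/
def negSet (A : Set ℤ) : Set ℤ := {x | -x ∈ A}

/-- The partition `Ω̃(τ)`, obtained from `Ω(τ)` by merging all inversion-invariant orbits
(orbits `A` with `A = -A`) into a single block. -/
def omegaTilde (n : ℕ) (τ : Equiv.Perm ℤ) : Set (Set ℤ) :=
  {A | A ∈ orbitsOn n τ ∧ negSet A ≠ A} ∪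
    {B | B = ⋃₀ {A | A ∈ orbitsOn n τ ∧ negSet A = A} ∧ B.Nonempty}

/-- The annular non-crossing partitions of type B: `NC^B(p,q) = {Ω̃(τ) : τ ∈ S^B_nc(p,q)}`. -/
def NCB (p q : ℕ) : Set (Set (Set ℤ)) :=
  {π | ∃ τ ∈ SncB p q, π = omegaTilde (p + q) τ}

/-- The type B non-crossing partitions of the disc: `NC^B(n) = {Ω̃(τ) : τ ∈ B_n, τ ≤ γ_n}`. -/
def NCBdisc (n : ℕ) : Set (Set (Set ℤ)) :=
  {π | ∃ τ, inB n τ ∧ leB n τ (gammaDisc n) ∧ π = omegaTilde n τ}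

/-- Reverse refinement order on partitions: every block of `π` is contained in a block of `ρ`. -/
def refines (π ρ : Set (Set ℤ)) : Prop := ∀ A ∈ π, ∃ B ∈ ρ, A ⊆ B

/-- The rank of a partition of `{±1,…,±n}`:
`n` minus half the number of blocks `A` with `A ≠ -A`. -/
noncomputable def rankNCB (n : ℕ) (π : Set (Set ℤ)) : ℕ :=
  n - {A | A ∈ π ∧ negSet A ≠ A}.ncard / 2

/-- The inner point set `{±(p+1), …, ±(p+q)}`. -/
def innerSet (p q : ℕ) : Set ℤ := {x : ℤ | (p : ℤ) < |x| ∧ |x| ≤ (p : ℤ) + (q : ℤ)}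

/-- The connectivity of `π ∈ NC^B(p,q)`: half the number of blocks `A` with `A ≠ -A`
meeting both `{±1,…,±p}` and `{±(p+1),…,±(p+q)}`. -/
noncomputable def connectivity (p q : ℕ) (π : Set (Set ℤ)) : ℕ :=
  {A | A ∈ π ∧ negSet A ≠ A ∧ (A ∩ signedSet p).Nonempty ∧
    (A ∩ innerSet p q).Nonempty}.ncard / 2

/-- The number of exterior pairs of blocks `{A, -A}` (with `A ≠ -A`, `A ⊆ {±1,…,±p}`). -/
noncomputable def extPairs (p : ℕ) (π : Set (Set ℤ)) : ℕ :=
  {A | A ∈ π ∧ negSet A ≠ A ∧ A ⊆ signedSet p}.ncard / 2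

/-- The number of interior pairs of blocks `{A, -A}`
(with `A ≠ -A`, `A ⊆ {±(p+1),…,±(p+q)}`). -/
noncomputable def intPairs (p q : ℕ) (π : Set (Set ℤ)) : ℕ :=
  {A | A ∈ π ∧ negSet A ≠ A ∧ A ⊆ innerSet p q}.ncard / 2

/-- The minimum `0̂` of `NC^B(p,q)` (with `n = p+q`): the partition into singletons. -/
def botNCB (n : ℕ) : Set (Set ℤ) := {A | ∃ x ∈ signedSet n, A = {x}}

/-- The maximum `1̂` of `NC^B(p,q)` (with `n = p+q`): the partition with a single block. -/
def topNCB (n : ℕ) : Set (Set ℤ) := {signedSet n}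

/-- The orbit of `x` under the subgroup generated by `{τ, γ}`. -/
def jointOrbit (τ γ : Equiv.Perm ℤ) (x : ℤ) : Set ℤ :=
  {y | ∃ g ∈ Subgroup.closure ({τ, γ} : Set (Equiv.Perm ℤ)), g x = y}

/-- The orbits on `{±1,…,±n}` of the subgroup generated by `{τ, γ}`. -/
def jointOrbitsOn (n : ℕ) (τ γ : Equiv.Perm ℤ) : Set (Set ℤ) :=
  {Y | ∃ x ∈ signedSet n, Y = jointOrbit τ γ x}


def Vn (n : ℕ) : Submodule ℚ (ℤ → ℚ) where
  carrier := {f | (∀ x, f (-x) = -f x) ∧ ∀ x, x ∉ signedSet n → f x = 0}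
  add_mem' := by
    rintro f g ⟨h1, h2⟩ ⟨h3, h4⟩
    refine ⟨fun x => ?_, fun x hx => ?_⟩
    · simp only [Pi.add_apply, h1, h3]; ring
    · simp [h2 x hx, h4 x hx]
  zero_mem' := by simp
  smul_mem' := by
    rintro c f ⟨h1, h2⟩
    refine ⟨fun x => ?_, fun x hx => ?_⟩
    · simp [h1]
    · simp [h2 x hx]

def FixS (n : ℕ) (τ : Equiv.Perm ℤ) : Submodule ℚ (ℤ → ℚ) where
  carrier := {f | f ∈ Vn n ∧ ∀ x, f (τ x) = f x}
  add_mem' := by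
    rintro f g ⟨h1, h2⟩ ⟨h3, h4⟩
    exact ⟨(Vn n).add_mem h1 h3, fun x => by simp [h2, h4]⟩
  zero_mem' := ⟨(Vn n).zero_mem, by simp⟩
  smul_mem' := by
    rintro c f ⟨h1, h2⟩
    exact ⟨(Vn n).smul_mem c h1, fun x => by simp [h2]⟩

lemma mem_FixS {n : ℕ} {τ : Equiv.Perm ℤ} {f : ℤ → ℚ} :
    f ∈ FixS n τ ↔ f ∈ Vn n ∧ ∀ x, f (τ x) = f x := Iff.rfl

lemma mem_Vn {n : ℕ} {f : ℤ → ℚ} :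
    f ∈ Vn n ↔ (∀ x, f (-x) = -f x) ∧ ∀ x, x ∉ signedSet n → f x = 0 := Iff.rfl

lemma mem_signedSet {n : ℕ} {x : ℤ} : x ∈ signedSet n ↔ x ≠ 0 ∧ -(n:ℤ) ≤ x ∧ x ≤ n := by
  unfold signedSet; simp [abs_le]

lemma Vn_zero {n : ℕ} {f : ℤ → ℚ} (h : f ∈ Vn n) : f 0 = 0 :=
  h.2 0 (by simp [mem_signedSet])

def VnEquiv (n : ℕ) : Vn n ≃ₗ[ℚ] (Fin n → ℚ) where
  toFun f i := f.1 ((i : ℕ) + 1 : ℤ)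
  map_add' f g := by ext i; simp
  map_smul' c f := by ext i; simp
  invFun g := ⟨fun z => if h : 1 ≤ z ∧ z ≤ n then g ⟨(z - 1).toNat, by omega⟩ else
      if h : 1 ≤ -z ∧ -z ≤ n then - g ⟨(-z - 1).toNat, by omega⟩ else 0, by
    refine ⟨fun x => ?_, fun x hx => ?_⟩
    · by_cases h1 : 1 ≤ x ∧ x ≤ n
      · have h2 : ¬ (1 ≤ -x ∧ -x ≤ n) := by omega
        simp [h1, h2]
      · by_cases h2 : 1 ≤ -x ∧ -x ≤ n
        · simp only [dif_neg h1, dif_pos h2]; simp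
        · simp only [dif_neg h1, dif_neg h2, neg_neg]; simp
    · rw [mem_signedSet] at hx
      simp only
      rw [dif_neg (by omega), dif_neg (by omega)]⟩
  left_inv := by
    rintro ⟨f, h1, h2⟩
    ext z
    simp only
    by_cases h3 : 1 ≤ z ∧ z ≤ n
    · rw [dif_pos h3]; congr 1; omega
    · rw [dif_neg h3]
      by_cases h4 : 1 ≤ -z ∧ -z ≤ n
      · rw [dif_pos h4, ← h1]; congr 1; omega
      · rw [dif_neg h4, h2]; rw [mem_signedSet]; omega
  right_inv := by
    intro g
    ext i
    simp only
    rw [dif_pos (by omega)]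
    congr 1; ext; simp

lemma finrank_Vn (n : ℕ) : Module.finrank ℚ (Vn n) = n := by
  rw [(VnEquiv n).finrank_eq]; simp

instance (n : ℕ) : FiniteDimensional ℚ (Vn n) := Module.Finite.equiv (VnEquiv n).symm

lemma FixS_le (n τ) : FixS n τ ≤ Vn n := fun _ h => h.1

instance (n : ℕ) (τ) : FiniteDimensional ℚ (FixS n τ) :=
  Submodule.finiteDimensional_of_le (FixS_le n τ)

lemma FixS_one (n) : FixS n 1 = Vn n := by
  apply le_antisymm (FixS_le n 1)
  intro f hf; exact ⟨hf, fun x => rfl⟩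

/-- basis vectors -/
def eb (y z : ℤ) : ℚ := (if z = y then 1 else 0) - (if z = -y then 1 else 0)

lemma eb_mem {n : ℕ} {y : ℤ} (hy : y ∈ signedSet n) : eb y ∈ Vn n := by
  rw [mem_signedSet] at hy
  refine ⟨fun x => ?_, fun x hx => ?_⟩
  · unfold eb
    have h1 : (-x = -y) ↔ (x = y) := by simp
    have h2 : (-x = y) ↔ (x = -y) := by rw [neg_eq_iff_eq_neg]
    simp only [h1, h2]
    ring
  · rw [mem_signedSet] at hx
    unfold eb
    rw [if_neg (by omega), if_neg (by omega)]; simp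

lemma eb_perm {n : ℕ} {τ : Equiv.Perm ℤ} (hτ : inB n τ) (y z : ℤ) : eb (τ y) (τ z) = eb y z := by
  unfold eb
  rw [← hτ.1]; simp

lemma eb_self {y : ℤ} (h : y ≠ 0) : eb y y = 1 := by
  unfold eb; rw [if_pos rfl, if_neg (by omega)]; simp

lemma eb_eq_one {y z : ℤ} (h : eb y z = 1) : z = y := by
  unfold eb at h
  split_ifs at h with h1 h2 <;> norm_num at h <;> assumption

lemma inB_mem {n : ℕ} {τ : Equiv.Perm ℤ} (hτ : inB n τ) {x : ℤ} (hx : x ∈ signedSet n) :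
    τ x ∈ signedSet n := by
  by_contra h
  have := hτ.2 _ h
  exact h ((τ.injective this).symm ▸ hx)

lemma inB_zero {n : ℕ} {τ : Equiv.Perm ℤ} (hτ : inB n τ) : τ 0 = 0 :=
  hτ.2 0 (by simp [mem_signedSet])

lemma inB_one (n) : inB n 1 := ⟨fun _ => rfl, fun _ _ => rfl⟩

lemma inB_mul {n : ℕ} {τ σ : Equiv.Perm ℤ} (hτ : inB n τ) (hσ : inB n σ) : inB n (τ * σ) := by
  refine ⟨fun x => ?_, fun x hx => ?_⟩
  · simp [Equiv.Perm.mul_apply, hσ.1, hτ.1]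
  · simp [Equiv.Perm.mul_apply, hσ.2 x hx, hτ.2 x hx]

lemma inB_inv {n : ℕ} {τ : Equiv.Perm ℤ} (hτ : inB n τ) : inB n τ⁻¹ := by
  refine ⟨fun x => ?_, fun x hx => ?_⟩
  · rw [Equiv.Perm.inv_eq_iff_eq, hτ.1]; simp
  · rw [Equiv.Perm.inv_eq_iff_eq, hτ.2 x hx]

lemma refl_fix {n : ℕ} {a b : ℤ} (f : ℤ → ℚ) (hf : f ∈ Vn n) (hab : f a = f b) (z : ℤ) :
    f ((Equiv.swap a b * Equiv.swap (-a) (-b)) z) = f z := by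
  have h1 := hf.1 a
  have h2 := hf.1 b
  rw [Equiv.Perm.mul_apply]
  simp only [Equiv.swap_apply_def]
  have h3 : ∀ w, w = -a → f w = - f a := by rintro w rfl; exact h1
  have h4 : ∀ w, w = -b → f w = - f b := by rintro w rfl; exact h2
  split_ifs <;> grind

lemma refl_fix' {n : ℕ} {a : ℤ} (f : ℤ → ℚ) (hf : f ∈ Vn n) (hab : f a = f (-a)) (z : ℤ) :
    f ((Equiv.swap a (-a)) z) = f z := by
  simp only [Equiv.swap_apply_def]
  split_ifs <;> simp_all

lemma gen_fix {n : ℕ} {g : Equiv.Perm ℤ} (hg : g ∈ genB n) :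
    ∃ a b : ℤ, ∀ f ∈ Vn n, f a = f b → ∀ z, f (g z) = f z := by
  rcases hg with ⟨i, j, -, -, -, -, -, rfl⟩ | ⟨i, j, -, -, -, -, -, rfl⟩ | ⟨i, -, -, rfl⟩
  · exact ⟨i, j, fun f hf h z => refl_fix f hf h z⟩
  · refine ⟨i, -j, fun f hf h z => ?_⟩
    have := refl_fix f hf h z
    rwa [neg_neg] at this
  · exact ⟨i, -i, fun f hf h z => refl_fix' f hf h z⟩

lemma finrank_inf_ker (P : Submodule ℚ (ℤ → ℚ)) [FiniteDimensional ℚ P] (φ : (ℤ → ℚ) →ₗ[ℚ] ℚ) :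
    Module.finrank ℚ P ≤ Module.finrank ℚ (P ⊓ LinearMap.ker φ : Submodule ℚ (ℤ → ℚ)) + 1 := by
  have h := LinearMap.finrank_range_add_finrank_ker (φ.comp P.subtype)
  have h2 : Module.finrank ℚ (LinearMap.range (φ.comp P.subtype)) ≤ 1 := by
    have := Submodule.finrank_le (LinearMap.range (φ.comp P.subtype))
    simpa using this
  have h3 : Module.finrank ℚ (LinearMap.ker (φ.comp P.subtype)) =
      Module.finrank ℚ (P ⊓ LinearMap.ker φ : Submodule ℚ (ℤ → ℚ)) := by
    rw [LinearMap.ker_comp]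
    have h4 : (P ⊓ LinearMap.ker φ) = ((LinearMap.ker φ).comap P.subtype).map P.subtype := by
      rw [Submodule.map_comap_subtype]
    rw [h4, Submodule.finrank_map_subtype_eq]
  omega

lemma finrank_gen_mul {n : ℕ} {g : Equiv.Perm ℤ} (hg : g ∈ genB n) (τ : Equiv.Perm ℤ) :
    Module.finrank ℚ (FixS n τ) ≤ Module.finrank ℚ (FixS n (g * τ)) + 1 := by
  obtain ⟨a, b, hab⟩ := gen_fix hg
  let φ : (ℤ → ℚ) →ₗ[ℚ] ℚ := LinearMap.proj (R := ℚ) (φ := fun _ : ℤ => ℚ) a - LinearMap.proj (R := ℚ) (φ := fun _ : ℤ => ℚ) b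
  refine (finrank_inf_ker (FixS n τ) φ).trans ?_
  gcongr
  apply Submodule.finrank_mono
  rintro f ⟨⟨hf1, hf2⟩, hf3⟩
  refine ⟨hf1, fun x => ?_⟩
  rw [Equiv.Perm.mul_apply, hab f hf1 _ _, hf2]
  have : f a - f b = 0 := hf3
  linarith

lemma le_of_list {n : ℕ} (l : List (Equiv.Perm ℤ)) (hl : ∀ g ∈ l, g ∈ genB n) :
    n ≤ Module.finrank ℚ (FixS n l.prod) + l.length := by
  induction l with
  | nil =>
    have : FixS n ([] : List (Equiv.Perm ℤ)).prod = Vn n := FixS_one n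
    rw [this, finrank_Vn]; simp
  | cons g l ih =>
    have h1 := ih (fun g hg => hl g (by simp [hg]))
    have h2 := finrank_gen_mul (hl g (by simp)) l.prod
    have h3 : (g :: l).prod = g * l.prod := List.prod_cons
    rw [h3, List.length_cons]
    omega

lemma swap_comm4 {a b : ℤ} (ha : a ≠ 0) (hb : b ≠ 0) (hab : a ≠ b) (hab' : a ≠ -b) :
    Equiv.swap a b * Equiv.swap (-a) (-b) = Equiv.swap (-a) (-b) * Equiv.swap a b := by
  apply Equiv.Perm.Disjoint.commute
  intro x
  simp only [Equiv.swap_apply_def]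
  split_ifs <;> omega

lemma refl_exists {n : ℕ} {a b : ℤ} (ha : a ∈ signedSet n) (hb : b ∈ signedSet n) (hab : a ≠ b) :
    ∃ t ∈ genB n, inB n t ∧ t b = a ∧ t * t = 1 ∧ ∀ f ∈ Vn n, f a = f b → ∀ z, f (t z) = f z := by
  have ha' := ha
  have hb' := hb
  rw [mem_signedSet] at ha hb
  by_cases h : b = -a
  · subst h
    refine ⟨Equiv.swap a (-a), ?_, ⟨fun x => ?_, fun x hx => ?_⟩, by simp, by simp,
      fun f hf h z => refl_fix' f hf h z⟩
    · right; right
      rcases lt_or_gt_of_ne ha.1 with h0 | h0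
      · exact ⟨-a, by omega, by omega, by rw [neg_neg, Equiv.swap_comm]⟩
      · exact ⟨a, by omega, by omega, rfl⟩
    · simp only [Equiv.swap_apply_def]
      split_ifs <;> omega
    · rw [mem_signedSet] at hx
      simp only [Equiv.swap_apply_def]
      split_ifs <;> omega
  · have hc := swap_comm4 ha.1 hb.1 hab (by omega)
    refine ⟨Equiv.swap a b * Equiv.swap (-a) (-b), ?_, ⟨fun x => ?_, fun x hx => ?_⟩, ?_, ?_,
      fun f hf h z => refl_fix f hf h z⟩
    · rcases lt_or_gt_of_ne ha.1 with h0 | h0 <;> rcases lt_or_gt_of_ne hb.1 with h1 | h1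
      · left
        exact ⟨-a, -b, by omega, by omega, by omega, by omega, by omega, by
          rw [neg_neg, neg_neg, hc]⟩
      · right; left
        exact ⟨-a, b, by omega, by omega, by omega, by omega, by omega, by
          rw [neg_neg, hc]⟩
      · right; left
        exact ⟨a, -b, by omega, by omega, by omega, by omega, by omega, by
          rw [neg_neg]⟩
      · left
        exact ⟨a, b, by omega, by omega, by omega, by omega, by omega, rfl⟩
    · simp only [Equiv.Perm.mul_apply, Equiv.swap_apply_def]
      split_ifs <;> omega
    · rw [mem_signedSet] at hx
      simp only [Equiv.Perm.mul_apply, Equiv.swap_apply_def]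
      split_ifs <;> omega
    · simp only [Equiv.Perm.mul_apply, Equiv.swap_apply_def]
      split_ifs <;> omega
    · nth_rewrite 1 [hc]
      rw [mul_assoc, ← mul_assoc (Equiv.swap a b)]
      simp

lemma carter {n : ℕ} (k : ℕ) : ∀ τ : Equiv.Perm ℤ, inB n τ → n ≤ Module.finrank ℚ (FixS n τ) + k →
    ∃ l : List (Equiv.Perm ℤ), (∀ g ∈ l, g ∈ genB n) ∧ l.prod = τ ∧
      l.length + Module.finrank ℚ (FixS n τ) ≤ n := by
  induction k with
  | zero =>
    intro τ hτ hk
    have h1 : FixS n τ = Vn n := by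
      apply Submodule.eq_of_le_of_finrank_le (FixS_le n τ)
      rw [finrank_Vn]; omega
    refine ⟨[], by simp, ?_, by rw [h1, finrank_Vn]; simp⟩
    simp only [List.prod_nil]
    ext x
    by_cases hx : x ∈ signedSet n
    · have h2 := eb_mem hx
      rw [← h1] at h2
      have h3 := h2.2 x
      rw [eb_self (mem_signedSet.1 hx).1] at h3
      exact (eb_eq_one h3).symm
    · exact (hτ.2 x hx).symm
  | succ k ih =>
    intro τ hτ hk
    by_cases h1 : τ = 1
    · subst h1
      exact ⟨[], by simp, rfl, by rw [FixS_one, finrank_Vn]; simp⟩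
    · obtain ⟨x, hx⟩ : ∃ x, τ x ≠ x := by
        by_contra! h
        exact h1 (Equiv.ext h)
      have hxs : x ∈ signedSet n := by
        by_contra h
        exact hx (hτ.2 x h)
      obtain ⟨t, ht, htB, htx, htt, htf⟩ := refl_exists hxs (inB_mem hτ hxs) (Ne.symm hx)
      have hlt : FixS n τ < FixS n (t * τ) := by
        apply lt_of_le_of_ne
        · intro f hf
          refine ⟨hf.1, fun z => ?_⟩
          rw [Equiv.Perm.mul_apply, htf f hf.1 (hf.2 x).symm, hf.2]
        · intro h
          have h2 : eb x ∈ FixS n (t * τ) := by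
            refine ⟨eb_mem hxs, fun z => ?_⟩
            have := eb_perm (inB_mul htB hτ) x z
            rwa [Equiv.Perm.mul_apply, htx] at this
          rw [← h] at h2
          have h3 := h2.2 x
          rw [eb_self (mem_signedSet.1 hxs).1] at h3
          exact hx (eb_eq_one h3)
      have hlt' := Submodule.finrank_lt_finrank_of_lt hlt
      obtain ⟨l, hl1, hl2, hl3⟩ := ih (t * τ) (inB_mul htB hτ) (by omega)
      refine ⟨t :: l, ?_, ?_, ?_⟩
      · intro g hg
        rcases List.mem_cons.1 hg with rfl | hg
        · exact ht
        · exact hl1 g hg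
      · rw [List.prod_cons, hl2, ← mul_assoc, htt, one_mul]
      · simp only [List.length_cons]; omega

lemma lenB_add {n : ℕ} {τ : Equiv.Perm ℤ} (hτ : inB n τ) :
    lenB n τ + Module.finrank ℚ (FixS n τ) = n := by
  obtain ⟨l, h1, h2, h3⟩ := carter n τ hτ (by omega)
  have hmem : l.length ∈ {k : ℕ | ∃ l : List (Equiv.Perm ℤ),
    l.length = k ∧ (∀ g ∈ l, g ∈ genB n) ∧ l.prod = τ} := ⟨l, rfl, h1, h2⟩
  have h4 : lenB n τ ≤ l.length := Nat.sInf_le hmem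
  obtain ⟨l', h5, h6, h7⟩ := Nat.sInf_mem ⟨_, hmem⟩
  have h8 := le_of_list l' h6
  rw [h7] at h8
  change l'.length = lenB n τ at h5
  omega

lemma span_eb {n : ℕ} (W : Submodule ℚ (ℤ → ℚ)) (h : ∀ x ∈ signedSet n, eb x ∈ W) : Vn n ≤ W := by
  intro f hf
  have : f = ∑ x ∈ Finset.Icc (1:ℤ) n, f x • eb x := by
    ext z
    rw [Finset.sum_apply]
    simp only [Pi.smul_apply, smul_eq_mul, eb, mul_sub, Finset.sum_sub_distrib]
    simp only [mul_ite, mul_one, mul_zero, Finset.sum_ite_eq]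
    have h2 : ∀ x, (z = -x) = (-z = x) := by intro x; simp only [eq_iff_iff]; omega
    simp only [h2, Finset.sum_ite_eq, Finset.mem_Icc]
    by_cases hz : z ∈ signedSet n
    · rw [mem_signedSet] at hz
      rcases lt_or_gt_of_ne hz.1 with h0 | h0
      · rw [if_neg (by omega), if_pos (by omega), hf.1]; ring
      · rw [if_pos (by omega), if_neg (by omega)]; ring
    · rw [hf.2 z hz]
      rw [mem_signedSet] at hz
      rw [if_neg (by omega), if_neg (by omega)]; ring
  rw [this]
  refine Submodule.sum_mem _ fun x hx => Submodule.smul_mem _ _ (h x ?_)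
  rw [Finset.mem_Icc] at hx
  rw [mem_signedSet]; omega

/-- Criterion -/
lemma crit {n : ℕ} {τ γ : Equiv.Perm ℤ} (hτ : inB n τ) (hγ : inB n γ) (hfix : FixS n γ = ⊥) :
    leB n τ γ ↔ ∀ x ∈ signedSet n, ∃ a ∈ FixS n τ, ∀ z, a z - a (γ z) = eb x z - eb (τ x) (γ z) := by
  have hinv := inB_mul (inB_inv hτ) hγ
  have h1 := lenB_add hτ
  have h2 := lenB_add hγ
  have h3 := lenB_add hinv
  rw [hfix, finrank_bot] at h2
  have h4 : FixS n τ ⊓ FixS n (τ⁻¹ * γ) = ⊥ := by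
    rw [eq_bot_iff, ← hfix]
    rintro f ⟨hf1, hf2⟩
    refine ⟨hf1.1, fun x => ?_⟩
    have := hf2.2 x
    have h9 : f (γ x) = f (τ⁻¹ (γ x)) := by simpa using hf1.2 (τ⁻¹ (γ x))
    rw [← this, Equiv.Perm.mul_apply, h9]
  have h5 := Submodule.finrank_sup_add_finrank_inf_eq (FixS n τ) (FixS n (τ⁻¹ * γ))
  rw [h4, finrank_bot] at h5
  have h6 : FixS n τ ⊔ FixS n (τ⁻¹ * γ) ≤ Vn n := sup_le (FixS_le _ _) (FixS_le _ _)
  have h7 : leB n τ γ ↔ Vn n ≤ FixS n τ ⊔ FixS n (τ⁻¹ * γ) := by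
    unfold leB
    constructor
    · intro h
      rw [Submodule.eq_of_le_of_finrank_le h6]
      rw [finrank_Vn]; omega
    · intro h
      have h8 := le_antisymm h h6
      rw [← h8, finrank_Vn] at h5
      omega
  rw [h7]
  have key : ∀ (x : ℤ) (a b : ℤ → ℚ), a ∈ FixS n τ → a + b = eb x →
      ∀ z, b ((τ⁻¹ * γ) z) = b z ↔ a z - a (γ z) = eb x z - eb (τ x) (γ z) := by
    intro x a b ha hab z
    have hb : ∀ w, b w = eb x w - a w := fun w => by rw [← hab]; simp
    rw [hb, hb, Equiv.Perm.mul_apply]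
    have e1 : a (τ⁻¹ (γ z)) = a (γ z) := by rw [← ha.2]; simp
    have e2 : eb x (τ⁻¹ (γ z)) = eb (τ x) (γ z) := by rw [← eb_perm hτ]; simp
    rw [e1, e2]
    constructor <;> intro h <;> linarith
  constructor
  · intro h x hx
    obtain ⟨a, ha, b, hb, hab⟩ := Submodule.mem_sup.1 (h (eb_mem hx))
    exact ⟨a, ha, fun z => (key x a b ha hab z).1 (hb.2 z)⟩
  · intro h
    apply span_eb
    intro x hx
    obtain ⟨a, ha, haz⟩ := h x hx
    refine Submodule.mem_sup.2 ⟨a, ha, eb x - a, ⟨?_, fun z => ?_⟩, by simp⟩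
    · exact (Vn n).sub_mem (eb_mem hx) ha.1
    · exact (key x a _ ha (by simp) z).2 (haz z)

/-- `Ω̃` determines the fixed space -/
lemma FixS_omega {n : ℕ} {τ : Equiv.Perm ℤ} (hτ : inB n τ) (f : ℤ → ℚ) :
    f ∈ FixS n τ ↔ f ∈ Vn n ∧ ∀ A ∈ omegaTilde n τ, ∀ x ∈ A, ∀ y ∈ A, f x = f y := by
  constructor
  · rintro ⟨hf, hf2⟩
    refine ⟨hf, ?_⟩
    have hpow : ∀ (k : ℤ) x, f ((τ ^ k) x) = f x := by
      intro k
      induction k using Int.induction_on with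
      | zero => intro x; rfl
      | succ i ih => intro x; rw [zpow_add, Equiv.Perm.mul_apply, ih, zpow_one, hf2]
      | pred i ih =>
        intro x
        rw [zpow_sub, Equiv.Perm.mul_apply, ih, zpow_one, ← hf2]; simp
    have horb : ∀ x, ∀ y ∈ permOrbit τ x, f y = f x := by
      rintro x y ⟨k, rfl⟩; exact hpow k x
    rintro A (⟨⟨x, hx, rfl⟩, -⟩ | ⟨rfl, -⟩) y hy z hz
    · rw [horb x y hy, horb x z hz]
    · have h0 : ∀ y ∈ ⋃₀ {A | A ∈ orbitsOn n τ ∧ negSet A = A}, f y = 0 := by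
        rintro y ⟨A, ⟨⟨x, hx, rfl⟩, hneg⟩, hy⟩
        have h1 : -y ∈ permOrbit τ x := by
          rw [← hneg] at hy; exact hy
        have h2 := horb x y hy
        have h3 := horb x _ h1
        rw [hf.1] at h3
        linarith
      rw [h0 y hy, h0 z hz]
  · rintro ⟨hf, h⟩
    refine ⟨hf, fun x => ?_⟩
    by_cases hx : x ∈ signedSet n
    · have hA : permOrbit τ x ∈ orbitsOn n τ := ⟨x, hx, rfl⟩
      have hx1 : x ∈ permOrbit τ x := ⟨0, rfl⟩
      have hx2 : τ x ∈ permOrbit τ x := ⟨1, by simp⟩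
      by_cases hn : negSet (permOrbit τ x) = permOrbit τ x
      · have hsub : ∀ y ∈ permOrbit τ x, y ∈ ⋃₀ {A | A ∈ orbitsOn n τ ∧ negSet A = A} :=
          fun y hy => ⟨_, ⟨hA, hn⟩, hy⟩
        exact h _ (Or.inr ⟨rfl, ⟨x, hsub x hx1⟩⟩) _ (hsub _ hx2) _ (hsub _ hx1)
      · exact h _ (Or.inl ⟨hA, hn⟩) _ hx2 _ hx1
    · rw [hτ.2 x hx]

lemma omega_inj {n : ℕ} {τ σ γ : Equiv.Perm ℤ} (hτ : inB n τ) (hσ : inB n σ) (hγ : inB n γ)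
    (hfix : FixS n γ = ⊥) (h1 : leB n τ γ) (h2 : leB n σ γ)
    (h : omegaTilde n τ = omegaTilde n σ) : τ = σ := by
  have hF : FixS n τ = FixS n σ := by
    ext f; rw [FixS_omega hτ, FixS_omega hσ, h]
  rw [crit hτ hγ hfix] at h1
  rw [crit hσ hγ hfix] at h2
  ext x
  by_cases hx : x ∈ signedSet n
  · obtain ⟨a, ha, ha2⟩ := h1 x hx
    obtain ⟨b, hb, hb2⟩ := h2 x hx
    have hb' := hb
    rw [← hF] at hb'
    have hc : a - b ∈ FixS n τ := (FixS n τ).sub_mem ha hb'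
    have hc' : a - b ∈ FixS n σ := by rw [← hF]; exact hc
    set c := a - b with hcdef
    have hcz : ∀ z, c z - c (γ z) = eb (σ x) (γ z) - eb (τ x) (γ z) := by
      intro z
      have := ha2 z
      have := hb2 z
      simp only [hcdef, Pi.sub_apply]; linarith
    have hcx : c (τ x) = c (σ x) := by rw [hc.2, hc'.2]
    let I := Finset.Icc (-(n:ℤ)) n
    have hsupp : ∀ z, z ∉ I → z ∉ signedSet n := by
      intro z hz; simp only [I, Finset.mem_Icc] at hz; rw [mem_signedSet]; omega
    have hγI : ∀ z, z ∈ I ↔ γ z ∈ I := by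
      intro z
      by_cases hz : z ∈ signedSet n
      · have := inB_mem hγ hz
        rw [mem_signedSet] at hz this
        simp only [I, Finset.mem_Icc]; omega
      · rw [hγ.2 z hz]
    have hshift : ∀ g : ℤ → ℚ, ∑ z ∈ I, g (γ z) = ∑ z ∈ I, g z := by
      intro g
      exact Finset.sum_equiv γ hγI (fun _ _ => rfl)
    have hsumeb : ∀ y ∈ signedSet n, ∑ z ∈ I, c z * eb y z = 2 * c y := by
      intro y hy
      rw [mem_signedSet] at hy
      simp only [eb, mul_sub, Finset.sum_sub_distrib, mul_ite, mul_one, mul_zero,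
        Finset.sum_ite_eq']
      rw [if_pos (by simp only [I, Finset.mem_Icc]; omega),
        if_pos (by simp only [I, Finset.mem_Icc]; omega), hc.1.1]
      ring
    have hs1 : ∑ z ∈ I, c (γ z) * (c z - c (γ z)) = 0 := by
      have : ∀ z, c (γ z) * (c z - c (γ z)) = c (γ z) * eb (σ x) (γ z) - c (γ z) * eb (τ x) (γ z) := by
        intro z; rw [hcz]; ring
      simp only [this]
      rw [hshift (fun z => c z * eb (σ x) z - c z * eb (τ x) z), Finset.sum_sub_distrib,
        hsumeb _ (inB_mem hσ hx), hsumeb _ (inB_mem hτ hx), hcx]; ring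
    have hs2 : ∑ z ∈ I, (c z - c (γ z))^2 = 0 := by
      have e : ∀ z, (c z - c (γ z))^2 = c z ^ 2 - c (γ z) ^2 - 2 * (c (γ z) * (c z - c (γ z))) := by
        intro z; ring
      simp only [e]
      rw [Finset.sum_sub_distrib, ← Finset.mul_sum, hs1, Finset.sum_sub_distrib,
        hshift (fun z => c z ^ 2)]; ring
    rw [Finset.sum_eq_zero_iff_of_nonneg (fun _ _ => sq_nonneg _)] at hs2
    have h3 : ∀ z ∈ I, eb (σ x) (γ z) = eb (τ x) (γ z) := by
      intro z hz
      have := hs2 z hz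
      have := hcz z
      have : c z - c (γ z) = 0 := by simpa using hs2 z hz
      linarith
    have h4 : τ x ∈ I := by
      by_contra h; exact hsupp _ h (inB_mem hτ hx)
    obtain ⟨w, hw⟩ := γ.surjective (τ x)
    have h5 := h3 w (by rw [hγI, hw]; exact h4)
    rw [hw, eb_self (mem_signedSet.1 (inB_mem hτ hx)).1] at h5
    exact eb_eq_one h5
  · rw [hτ.2 x hx, hσ.2 x hx]


def uu (m : ℕ) (x : ℤ) : ℤ :=
  if x % (2 * (m:ℤ)) < m then x % (2 * (m:ℤ)) + 1 else -(x % (2 * (m:ℤ)) - m + 1)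

lemma uu_per2 (m : ℕ) (x k : ℤ) : uu m (x + 2 * m * k) = uu m x := by
  unfold uu; rw [Int.add_mul_emod_self_left]

lemma uu_lo {m : ℕ} {x : ℤ} (h0 : 0 ≤ x) (h1 : x < m) : uu m x = x + 1 := by
  unfold uu; rw [Int.emod_eq_of_lt h0 (by omega), if_pos h1]

lemma uu_hi {m : ℕ} {x : ℤ} (h0 : m ≤ x) (h1 : x < 2 * m) : uu m x = -(x - m + 1) := by
  unfold uu; rw [Int.emod_eq_of_lt (by omega) h1, if_neg (by omega)]

lemma red2 {m : ℕ} (hm : 0 < m) (x : ℤ) : ∃ r k : ℤ, x = r + 2 * m * k ∧ 0 ≤ r ∧ r < 2 * m := by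
  refine ⟨x % (2 * m), x / (2 * m), (Int.emod_add_mul_ediv x (2*m)).symm, ?_, ?_⟩
  · apply Int.emod_nonneg; omega
  · apply Int.emod_lt_of_pos; omega

lemma red1 {m : ℕ} (hm : 0 < m) (x : ℤ) : ∃ r k : ℤ, x = r + m * k ∧ 0 ≤ r ∧ r < m := by
  refine ⟨x % m, x / m, (Int.emod_add_mul_ediv x m).symm, ?_, ?_⟩
  · apply Int.emod_nonneg; omega
  · apply Int.emod_lt_of_pos; omega

lemma uu_neg {m : ℕ} (hm : 0 < m) (x : ℤ) : uu m (x + m) = - uu m x := by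
  obtain ⟨r, k, rfl, h0, h1⟩ := red2 hm x
  rw [uu_per2]
  by_cases h : r < m
  · rw [show r + 2 * m * k + m = (r + m) + 2 * m * k by ring, uu_per2, uu_lo h0 h,
      uu_hi (by omega) (by omega)]; ring
  · rw [show r + 2 * m * k + m = (r - m) + 2 * m * (k + 1) by ring, uu_per2,
      uu_lo (by omega) (by omega), uu_hi (by omega) (by omega)]; ring

lemma uu_neg' {m : ℕ} (hm : 0 < m) (x : ℤ) : uu m (x - m) = - uu m x := by
  have := uu_neg hm (x - m)
  rw [sub_add_cancel] at this
  omega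

lemma uu_mem {m : ℕ} (hm : 0 < m) (x : ℤ) : uu m x ∈ signedSet m := by
  obtain ⟨r, k, rfl, h0, h1⟩ := red2 hm x
  rw [uu_per2, mem_signedSet]
  by_cases h : r < m
  · rw [uu_lo h0 h]; omega
  · rw [uu_hi (by omega) h1]; omega

lemma uu_inj {m : ℕ} (hm : 0 < m) {x y : ℤ} (h : uu m x = uu m y) : ∃ k : ℤ, y = x + 2 * m * k := by
  obtain ⟨r, k, rfl, h0, h1⟩ := red2 hm x
  obtain ⟨r', k', rfl, h0', h1'⟩ := red2 hm y
  rw [uu_per2, uu_per2] at h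
  have : r = r' := by
    by_cases h2 : r < m <;> by_cases h3 : r' < m
    · rw [uu_lo h0 h2, uu_lo h0' h3] at h; omega
    · rw [uu_lo h0 h2, uu_hi (by omega) h1'] at h; omega
    · rw [uu_hi (by omega) h1, uu_lo h0' h3] at h; omega
    · rw [uu_hi (by omega) h1, uu_hi (by omega) h1'] at h; omega
  subst this
  exact ⟨k' - k, by ring⟩

lemma small_mulZ {M k : ℤ} (hM : 0 < M) (h1 : M * k < M) (h2 : -M < M * k) : k = 0 := by
  have : k < 1 := by nlinarith
  have : -1 < k := by nlinarith
  omega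

lemma uu_inj_lt {m : ℕ} (hm : 0 < m) {x y : ℤ} (h : uu m x = uu m y) (h1 : x - y < 2 * m)
    (h2 : y - x < 2 * m) : x = y := by
  obtain ⟨k, rfl⟩ := uu_inj hm h
  have := small_mulZ (M := 2 * (m:ℤ)) (k := k) (by omega) (by omega) (by omega)
  subst this; simp

lemma uu_surj {m : ℕ} {z : ℤ} (hz : z ∈ signedSet m) : ∃ x : ℤ, 0 ≤ x ∧ x < 2 * m ∧ uu m x = z := by
  rw [mem_signedSet] at hz
  by_cases h : 0 < z
  · exact ⟨z - 1, by omega, by omega, by rw [uu_lo (by omega) (by omega)]; ring⟩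
  · exact ⟨m - z - 1, by omega, by omega, by rw [uu_hi (by omega) (by omega)]; ring⟩

/-- surjectivity onto any window of length 2m -/
lemma uu_window {m : ℕ} (hm : 0 < m) {z : ℤ} (hz : z ∈ signedSet m) (a : ℤ) :
    ∃ x, a < x ∧ x ≤ a + 2 * m ∧ uu m x = z := by
  obtain ⟨x, -, -, hx⟩ := uu_surj hz
  obtain ⟨r, k, hr, h0, h1⟩ := red2 hm (x - (a + 1))
  refine ⟨r + a + 1, by omega, by omega, ?_⟩
  rw [← hx, show x = (r + a + 1) + 2 * m * k by linarith, uu_per2]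

lemma gamma_eq (m : ℕ) : gammaPQ m 1 = ((List.range (2 * m)).map fun i : ℕ => uu m i).formPerm *
    Equiv.swap ((m:ℤ) + 1) (-((m:ℤ)+1)) := by
  have hl : ∀ p : ℕ, (do let a ← List.range p; pure (a:ℤ)) = (List.range p).map (fun a : ℕ => (a:ℤ)) := by
    intro p
    simp [List.map_eq_flatMap]
  unfold gammaPQ
  rw [hl, hl]
  simp only [List.map_map]
  congr 1
  · congr 1
    rw [two_mul, List.range_add, List.map_append]
    congr 1
    · apply List.map_congr_left
      intro i hi
      rw [List.mem_range] at hi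
      simp only [Function.comp]
      rw [uu_lo (by omega) (by omega)]
    · rw [List.map_map]
      apply List.map_congr_left
      intro i hi
      rw [List.mem_range] at hi
      simp only [Function.comp]
      rw [uu_hi (by omega) (by omega)]; push_cast; ring

lemma list_nodup {m : ℕ} (hm : 0 < m) : ((List.range (2 * m)).map fun i : ℕ => uu m i).Nodup := by
  rw [List.nodup_map_iff_inj_on List.nodup_range]
  intro x hx y hy h
  rw [List.mem_range] at hx hy
  have := uu_inj_lt hm h (by omega) (by omega)
  omega

lemma gamma_uu {m : ℕ} (hm : 0 < m) (x : ℤ) : gammaPQ m 1 (uu m x) = uu m (x + 1) := by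
  have hx := uu_mem hm x
  rw [mem_signedSet] at hx
  rw [gamma_eq, Equiv.Perm.mul_apply, Equiv.swap_apply_of_ne_of_ne (by omega) (by omega)]
  obtain ⟨r, k, rfl, h0, h1⟩ := red2 hm x
  rw [show r + 2 * m * k + 1 = r + 1 + 2 * m * k by ring, uu_per2, uu_per2]
  lift r to ℕ using h0
  have h2 : r < 2 * m := by omega
  have := List.formPerm_apply_getElem _ (list_nodup hm) r (by simpa using h2)
  simp only [List.getElem_map, List.getElem_range, List.length_map, List.length_range] at this
  rw [this]
  by_cases h3 : r + 1 < 2 * m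
  · rw [Nat.mod_eq_of_lt h3]; push_cast; rfl
  · have h4 : r + 1 = 2 * m := by omega
    rw [h4, Nat.mod_self, show (r:ℤ) + 1 = (0:ℕ) + 2 * m * 1 by push_cast; omega, uu_per2]

lemma gamma_not {m : ℕ} (hm : 0 < m) {z : ℤ} (hz : z ∉ signedSet m) : gammaPQ m 1 z =
    Equiv.swap ((m:ℤ) + 1) (-((m:ℤ)+1)) z := by
  rw [gamma_eq, Equiv.Perm.mul_apply]
  apply List.formPerm_apply_of_notMem
  intro h
  rw [List.mem_map] at h
  obtain ⟨i, hi, h⟩ := h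
  have := uu_mem hm i
  rw [h, mem_signedSet, Equiv.swap_apply_def] at this
  rw [mem_signedSet] at hz
  split_ifs at this <;> omega

lemma gamma_top {m : ℕ} (hm : 0 < m) : gammaPQ m 1 ((m:ℤ)+1) = -((m:ℤ)+1) := by
  rw [gamma_not hm (by rw [mem_signedSet]; omega)]; simp

lemma gamma_bot {m : ℕ} (hm : 0 < m) : gammaPQ m 1 (-((m:ℤ)+1)) = ((m:ℤ)+1) := by
  rw [gamma_not hm (by rw [mem_signedSet]; omega)]; simp

lemma gamma_inB {m : ℕ} (hm : 0 < m) : inB (m + 1) (gammaPQ m 1) := by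
  refine ⟨fun x => ?_, fun x hx => ?_⟩
  · by_cases hx : x ∈ signedSet m
    · obtain ⟨y, -, -, rfl⟩ := uu_surj hx
      rw [← uu_neg hm, gamma_uu hm, gamma_uu hm, ← uu_neg hm]; congr 1; ring
    · rw [gamma_not hm hx, gamma_not hm (by rw [mem_signedSet] at *; omega)]
      simp only [Equiv.swap_apply_def]
      split_ifs <;> omega
  · rw [mem_signedSet] at hx
    push_cast at hx
    rw [gamma_not hm (by rw [mem_signedSet] at *; omega),
      Equiv.swap_apply_of_ne_of_ne (by omega) (by omega)]

lemma signed_cases {m : ℕ} {z : ℤ} (hz : z ∈ signedSet (m+1)) :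
    (∃ x, z = uu m x) ∨ z = (m:ℤ) + 1 ∨ z = -((m:ℤ)+1) := by
  by_cases h : z ∈ signedSet m
  · obtain ⟨x, -, -, h⟩ := uu_surj h
    exact Or.inl ⟨x, h.symm⟩
  · rw [mem_signedSet] at hz h
    push_cast at hz
    right; omega

lemma uu_mem' {m : ℕ} (hm : 0 < m) (x : ℤ) : uu m x ∈ signedSet (m+1) := by
  have := uu_mem hm x
  rw [mem_signedSet] at *
  push_cast; omega

lemma gamma_fix {m : ℕ} (hm : 0 < m) {f : ℤ → ℚ} (hf : f ∈ Vn (m+1))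
    (h : ∀ z, f (gammaPQ m 1 z) = f z) : f = 0 := by
  have h1 : ∀ k : ℕ, ∀ x, f (uu m (x + k)) = f (uu m x) := by
    intro k
    induction k with
    | zero => intro x; simp
    | succ k ih =>
      intro x
      rw [← ih x, ← h (uu m (x + k)), gamma_uu hm]; push_cast; congr 2; ring
  ext z
  by_cases hz : z ∈ signedSet (m+1)
  · rcases signed_cases hz with ⟨x, rfl⟩ | rfl | rfl
    · have := h1 m x
      rw [uu_neg hm, hf.1] at this
      simp only [Pi.zero_apply]; linarith
    · have := h ((m:ℤ)+1)
      rw [gamma_top hm, hf.1] at this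
      simp only [Pi.zero_apply]; linarith
    · have := h ((m:ℤ)+1)
      rw [gamma_top hm, hf.1] at this
      rw [hf.1]
      simp only [Pi.zero_apply]; linarith
  · exact hf.2 z hz

lemma gamma_fixS {m : ℕ} (hm : 0 < m) : FixS (m+1) (gammaPQ m 1) = ⊥ := by
  rw [eq_bot_iff]
  rintro f ⟨hf, h⟩
  exact gamma_fix hm hf h

/-- arc sums -/
noncomputable def arc (m : ℕ) (a b : ℤ) (z : ℤ) : ℚ := ∑ j ∈ Finset.Ico a b, eb (uu m j) z

lemma arc_mem {m : ℕ} (hm : 0 < m) (a b : ℤ) : arc m a b ∈ Vn (m+1) := by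
  have : arc m a b = ∑ j ∈ Finset.Ico a b, eb (uu m j) := by
    ext z; simp [arc, Finset.sum_apply]
  rw [this]
  exact Submodule.sum_mem _ fun j _ => eb_mem (uu_mem' hm j)

lemma arc_succ (m : ℕ) {a b : ℤ} (h : a ≤ b) (z : ℤ) :
    arc m a (b+1) z = arc m a b z + eb (uu m b) z := by
  unfold arc
  have : Finset.Ico a (b+1) = insert b (Finset.Ico a b) := by
    ext x; simp only [Finset.mem_insert, Finset.mem_Ico]; omega
  rw [this, Finset.sum_insert (by simp)]; ring

lemma arc_gamma {m : ℕ} (hm : 0 < m) {a b : ℤ} (h : a ≤ b) (z : ℤ) :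
    arc m a b z - arc m a b (gammaPQ m 1 z) =
      eb (uu m b) (gammaPQ m 1 z) - eb (uu m a) (gammaPQ m 1 z) := by
  induction b, h using Int.leInduction with
  | base => simp [arc]
  | succ b hb ih =>
    rw [arc_succ m hb, arc_succ m hb]
    have : eb (uu m (b+1)) (gammaPQ m 1 z) = eb (uu m b) z := by
      rw [← gamma_uu hm, eb_perm (gamma_inB hm)]
    linarith

lemma eb_uu_uu {m : ℕ} (hm : 0 < m) (j : ℤ) : eb (uu m j) (uu m j) = 1 :=
  eb_self (mem_signedSet.1 (uu_mem hm j)).1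

lemma eb_other {y z : ℤ} (h1 : z ≠ y) (h2 : z ≠ -y) : eb y z = 0 := by
  unfold eb; rw [if_neg h1, if_neg h2]; simp

lemma eb_neg_left (y z : ℤ) : eb (-y) z = - eb y z := by
  unfold eb; rw [neg_neg]; ring

lemma arc_val {m : ℕ} (hm : 0 < m) {a b : ℤ} (hab : b - a ≤ m) {j : ℤ} (h1 : a ≤ j) (h2 : j < b) :
    arc m a b (uu m j) = 1 := by
  unfold arc
  rw [Finset.sum_eq_single j]
  · exact eb_uu_uu hm j
  · intro i hi hij
    rw [Finset.mem_Ico] at hi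
    apply eb_other
    · intro h
      exact hij (uu_inj_lt hm h (by omega) (by omega)).symm
    · rw [← uu_neg hm]
      intro h
      obtain ⟨k, hk⟩ := uu_inj hm h
      have h3 : i - j = m * (2 * k - 1) := by linarith
      have := small_mulZ (M := (m:ℤ)) (k := 2 * k - 1) (by omega) (by omega) (by omega)
      omega
  · intro h; exact absurd (Finset.mem_Ico.2 ⟨h1, h2⟩) h

lemma eq_of_arc {m : ℕ} {a b z : ℤ} (h : 0 < arc m a b z) :
    ∃ j, a ≤ j ∧ j < b ∧ z = uu m j := by
  by_contra! hc
  have : arc m a b z ≤ 0 := by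
    unfold arc
    apply Finset.sum_nonpos
    intro j hj
    rw [Finset.mem_Ico] at hj
    have := hc j hj.1 hj.2
    unfold eb
    rw [if_neg this]
    split_ifs <;> norm_num
  linarith


def IsN (m : ℕ) (N : ℤ) : Prop := N = (m:ℤ) + 1 ∨ N = -((m:ℤ) + 1)

lemma IsN.neg {m : ℕ} {N : ℤ} (h : IsN m N) : IsN m (-N) := by
  unfold IsN at *; omega

lemma IsN.mem {m : ℕ} {N : ℤ} (h : IsN m N) : N ∈ signedSet (m+1) := by
  unfold IsN at h; rw [mem_signedSet]; push_cast; omega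

lemma IsN.ne_uu {m : ℕ} {N : ℤ} (h : IsN m N) (hm : 0 < m) (x : ℤ) : N ≠ uu m x := by
  have := uu_mem hm x
  unfold IsN at h; rw [mem_signedSet] at this; omega

lemma IsN.eq_or {m : ℕ} {N N' : ℤ} (h : IsN m N) (h' : IsN m N') : N' = N ∨ N' = -N := by
  unfold IsN at *; omega

lemma IsN.gamma {m : ℕ} {N : ℤ} (h : IsN m N) (hm : 0 < m) : gammaPQ m 1 N = -N := by
  rcases h with rfl | rfl
  · exact gamma_top hm
  · rw [gamma_bot hm]; ring

lemma signed_cases' {m : ℕ} {z : ℤ} (hz : z ∈ signedSet (m+1)) :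
    (∃ x, z = uu m x) ∨ IsN m z := signed_cases hz

structure Nonc (m : ℕ) (τ : Equiv.Perm ℤ) : Prop where
  inb : inB (m+1) τ
  fwd : ∀ X Y : ℤ, τ (uu m X) = uu m Y → X < Y → Y ≤ X + m → ∀ j, X < j → j < Y →
    ∃ j', X < j' ∧ j' < Y ∧ τ (uu m j) = uu m j'
  bwd : ∀ X Y : ℤ, τ (uu m X) = uu m Y → Y ≤ X → X < Y + m → ∀ j, Y ≤ j → j ≤ X →
    ∃ j', Y ≤ j' ∧ j' ≤ X ∧ τ (uu m j) = uu m j'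
  out : ∀ X N : ℤ, IsN m N → τ (uu m X) = N → ∀ j, X - m < j → j ≤ X →
    τ (uu m j) = N ∨ ∃ j', X - m < j' ∧ j' ≤ X ∧ τ (uu m j) = uu m j'
  out' : ∀ X N : ℤ, IsN m N → τ (uu m X) = N → ∃ v, X - m < v ∧ v ≤ X ∧ τ N = uu m v
  inn : ∀ v N : ℤ, IsN m N → τ N = uu m v → ∀ j, v ≤ j → j < v + m →
    τ (uu m j) = N ∨ ∃ j', v ≤ j' ∧ j' < v + m ∧ τ (uu m j) = uu m j'

lemma crit_uniq {m : ℕ} (hm : 0 < m) {τ : Equiv.Perm ℤ} (hτ : inB (m+1) τ)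
    (h : leB (m+1) τ (gammaPQ m 1)) {x : ℤ} (hx : x ∈ signedSet (m+1)) {f : ℤ → ℚ}
    (hf : f ∈ Vn (m+1))
    (hfe : ∀ z, f z - f (gammaPQ m 1 z) = eb x z - eb (τ x) (gammaPQ m 1 z)) :
    ∀ z, f (τ z) = f z := by
  obtain ⟨a, ha, hae⟩ := (crit hτ (gamma_inB hm) (gamma_fixS hm)).1 h x hx
  have : f - a = 0 := by
    apply gamma_fix hm (Submodule.sub_mem _ hf ha.1)
    intro z
    have h1 := hfe z
    have h2 := hae z
    simp only [Pi.sub_apply]; linarith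
  rw [sub_eq_zero] at this
  rw [this]; exact ha.2

noncomputable def sumeb (S : Finset ℤ) (z : ℤ) : ℚ := ∑ y ∈ S, eb y z

lemma closed_map {τ : Equiv.Perm ℤ} {S : Finset ℤ} (h : ∀ y ∈ S, τ y ∈ S) :
    S.map τ.toEmbedding = S := by
  apply Finset.eq_of_subset_of_card_le
  · intro y hy
    rw [Finset.mem_map] at hy
    obtain ⟨x, hx, rfl⟩ := hy
    exact h x hx
  · simp

lemma closed_pre {τ : Equiv.Perm ℤ} {S : Finset ℤ} (h : ∀ y ∈ S, τ y ∈ S) {y : ℤ} (hy : y ∈ S) :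
    ∃ x ∈ S, τ x = y := by
  rw [← closed_map h, Finset.mem_map] at hy
  exact hy

lemma sumeb_inv {n : ℕ} {τ : Equiv.Perm ℤ} (hτ : inB n τ) {S : Finset ℤ} (h : ∀ y ∈ S, τ y ∈ S)
    (z : ℤ) : sumeb S (τ z) = sumeb S z := by
  unfold sumeb
  conv_lhs => rw [← closed_map h]
  rw [Finset.sum_map]
  exact Finset.sum_congr rfl fun y _ => eb_perm hτ y z

lemma arc_sumeb {m : ℕ} (hm : 0 < m) {a b : ℤ} (hab : b ≤ a + m) (z : ℤ) :
    arc m a b z = sumeb ((Finset.Ico a b).image (uu m)) z := by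
  unfold arc sumeb
  rw [Finset.sum_image]
  intro x hx y hy h
  simp only [Finset.coe_Ico, Set.mem_Ico] at hx hy
  exact uu_inj_lt hm h (by omega) (by omega)

noncomputable def half (m : ℕ) (N a : ℤ) (z : ℤ) : ℚ := (eb N z + arc m a (a + m) z) / 2

lemma half_mem {m : ℕ} (hm : 0 < m) {N : ℤ} (hN : IsN m N) (a : ℤ) : half m N a ∈ Vn (m+1) := by
  have : half m N a = (1/2 : ℚ) • (eb N + arc m a (a+m)) := by
    ext z; simp [half]; ring
  rw [this]
  exact Submodule.smul_mem _ _ (Submodule.add_mem _ (eb_mem hN.mem) (arc_mem hm _ _))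

lemma eb_N_gamma {m : ℕ} (hm : 0 < m) {N : ℤ} (hN : IsN m N) (z : ℤ) :
    eb N (gammaPQ m 1 z) = - eb N z := by
  have := eb_perm (gamma_inB hm) N z
  rw [hN.gamma hm, eb_neg_left] at this
  linarith

lemma half_gamma {m : ℕ} (hm : 0 < m) {N : ℤ} (hN : IsN m N) (a z : ℤ) :
    half m N a z - half m N a (gammaPQ m 1 z) = eb N z - eb (uu m a) (gammaPQ m 1 z) := by
  have h1 := eb_N_gamma hm hN z
  have h2 := arc_gamma hm (show a ≤ a + m by omega) z
  rw [uu_neg hm, eb_neg_left] at h2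
  unfold half
  linarith

lemma half_gamma' {m : ℕ} (hm : 0 < m) {N : ℤ} (hN : IsN m N) (X z : ℤ) :
    half m N (X + 1 - m) z - half m N (X + 1 - m) (gammaPQ m 1 z)
      = eb (uu m X) z - eb N (gammaPQ m 1 z) := by
  rw [half_gamma hm hN, uu_neg' hm, eb_neg_left, eb_N_gamma hm hN, ← gamma_uu hm,
    eb_perm (gamma_inB hm)]
  ring

lemma halfN_pos {m : ℕ} {N a z : ℤ} (h : 0 < half m N a z) :
    z = N ∨ ∃ j, a ≤ j ∧ j < a + m ∧ z = uu m j := by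
  by_cases h1 : z = N
  · exact Or.inl h1
  · right
    apply eq_of_arc
    have : eb N z ≤ 0 := by
      unfold eb; rw [if_neg h1]; split_ifs <;> norm_num
    unfold half at h
    linarith

lemma half_N {m : ℕ} (hm : 0 < m) {N : ℤ} (hN : IsN m N) (a : ℤ) : 0 < half m N a N := by
  have : arc m a (a+m) N = 0 := by
    unfold arc
    apply Finset.sum_eq_zero
    intro j _
    apply eb_other (hN.ne_uu hm j)
    rw [← uu_neg hm]; exact hN.ne_uu hm _
  unfold half
  rw [this, eb_self]
  · norm_num
  · unfold IsN at hN; omega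

lemma half_uu {m : ℕ} (hm : 0 < m) {N : ℤ} (hN : IsN m N) {a j : ℤ} (h1 : a ≤ j) (h2 : j < a + m) :
    0 < half m N a (uu m j) := by
  unfold half
  rw [arc_val hm (by omega) h1 h2, eb_other]
  · norm_num
  · exact (hN.ne_uu hm j).symm
  · exact (hN.neg.ne_uu hm j).symm

lemma half_sumeb {m : ℕ} (hm : 0 < m) {N : ℤ} (hN : IsN m N) (a z : ℤ) :
    half m N a z = sumeb (insert N ((Finset.Ico a (a+m)).image (uu m))) z / 2 := by
  unfold half
  rw [arc_sumeb hm le_rfl]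
  unfold sumeb
  rw [Finset.sum_insert]
  intro h
  rw [Finset.mem_image] at h
  obtain ⟨x, _, h⟩ := h
  exact hN.ne_uu hm x h.symm

lemma nonc_of_snc {m : ℕ} (hm : 0 < m) {τ : Equiv.Perm ℤ} (hτ : inB (m+1) τ)
    (h : leB (m+1) τ (gammaPQ m 1)) : Nonc m τ where
  inb := hτ
  fwd := by
    intro X Y hXY h1 h2 j h3 h4
    have := crit_uniq hm hτ h (uu_mem' hm X) (f := - arc m (X+1) Y)
      (Submodule.neg_mem _ (arc_mem hm _ _)) (by
        intro z
        have h2 := arc_gamma hm (show X + 1 ≤ Y by omega) z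
        rw [← gamma_uu hm X, eb_perm (gamma_inB hm)] at h2
        rw [hXY]
        simp only [Pi.neg_apply]; linarith) (uu m j)
    simp only [Pi.neg_apply] at this
    rw [arc_val hm (by omega) (show X + 1 ≤ j by omega) h4] at this
    obtain ⟨j', h5, h6, h7⟩ := eq_of_arc (m := m) (a := X+1) (b := Y) (z := τ (uu m j)) (by linarith)
    exact ⟨j', by omega, h6, h7⟩
  bwd := by
    intro X Y hXY h1 h2 j h3 h4
    have := crit_uniq hm hτ h (uu_mem' hm X) (f := arc m Y (X+1)) (arc_mem hm _ _) (by
        intro z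
        have h2 := arc_gamma hm (show Y ≤ X + 1 by omega) z
        rw [← gamma_uu hm X, eb_perm (gamma_inB hm)] at h2
        rw [hXY]
        linarith) (uu m j)
    rw [arc_val hm (by omega) h3 (show j < X + 1 by omega)] at this
    obtain ⟨j', h5, h6, h7⟩ := eq_of_arc (m := m) (a := Y) (b := X+1) (z := τ (uu m j)) (by linarith)
    exact ⟨j', h5, by omega, h7⟩
  out := by
    intro X N hN hX j h1 h2
    have := crit_uniq hm hτ h (uu_mem' hm X) (half_mem hm hN (X + 1 - m)) (by
      intro z; rw [half_gamma' hm hN, hX]) (uu m j)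
    have h3 := half_uu hm hN (a := X + 1 - m) (j := j) (by omega) (by omega)
    rw [← this] at h3
    rcases halfN_pos h3 with h4 | ⟨j', h4, h5, h6⟩
    · exact Or.inl h4
    · exact Or.inr ⟨j', by omega, by omega, h6⟩
  out' := by
    intro X N hN hX
    have := crit_uniq hm hτ h (uu_mem' hm X) (half_mem hm hN (X + 1 - m)) (by
      intro z; rw [half_gamma' hm hN, hX]) N
    have h3 := half_N hm hN (X + 1 - m)
    rw [← this] at h3
    rcases halfN_pos h3 with h4 | ⟨j', h4, h5, h6⟩
    · exact absurd (τ.injective (h4.trans hX.symm)) (hN.ne_uu hm X)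
    · exact ⟨j', by omega, by omega, h6⟩
  inn := by
    intro v N hN hv j h1 h2
    have := crit_uniq hm hτ h hN.mem (half_mem hm hN v) (by
      intro z; rw [half_gamma hm hN, hv]) (uu m j)
    have h3 := half_uu hm hN h1 h2
    rw [← this] at h3
    exact halfN_pos h3

lemma arc_inv {m : ℕ} (hm : 0 < m) {τ : Equiv.Perm ℤ} (hτ : inB (m+1) τ) {a b : ℤ} (hab : b ≤ a + m)
    (h : ∀ j, a ≤ j → j < b → ∃ j', a ≤ j' ∧ j' < b ∧ τ (uu m j) = uu m j') (z : ℤ) :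
    arc m a b (τ z) = arc m a b z := by
  rw [arc_sumeb hm hab, arc_sumeb hm hab]
  apply sumeb_inv hτ
  intro y hy
  simp only [Finset.mem_image, Finset.mem_Ico] at hy ⊢
  obtain ⟨j, ⟨h1, h2⟩, rfl⟩ := hy
  obtain ⟨j', h3, h4, h5⟩ := h j h1 h2
  exact ⟨j', ⟨h3, h4⟩, h5.symm⟩

lemma half_inv {m : ℕ} (hm : 0 < m) {τ : Equiv.Perm ℤ} (hτ : inB (m+1) τ) {N a : ℤ} (hN : IsN m N)
    (h : ∀ j, a ≤ j → j < a + m → τ (uu m j) = N ∨ ∃ j', a ≤ j' ∧ j' < a + m ∧ τ (uu m j) = uu m j')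
    (h' : ∃ v, a ≤ v ∧ v < a + m ∧ τ N = uu m v) (z : ℤ) :
    half m N a (τ z) = half m N a z := by
  rw [half_sumeb hm hN, half_sumeb hm hN]
  congr 1
  apply sumeb_inv hτ
  intro y hy
  simp only [Finset.mem_insert, Finset.mem_image, Finset.mem_Ico] at hy ⊢
  rcases hy with rfl | ⟨j, ⟨h1, h2⟩, rfl⟩
  · obtain ⟨v, h1, h2, h3⟩ := h'
    exact Or.inr ⟨v, ⟨h1, h2⟩, h3.symm⟩
  · rcases h j h1 h2 with h3 | ⟨j', h3, h4, h5⟩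
    · exact Or.inl h3
    · exact Or.inr ⟨j', ⟨h3, h4⟩, h5.symm⟩

lemma snc_of_nonc {m : ℕ} (hm : 0 < m) {τ : Equiv.Perm ℤ} (h : Nonc m τ) :
    leB (m+1) τ (gammaPQ m 1) := by
  have hτ := h.inb
  rw [crit hτ (gamma_inB hm) (gamma_fixS hm)]
  intro x hx
  rcases signed_cases' hx with ⟨X, rfl⟩ | hN
  · rcases signed_cases' (inB_mem hτ hx) with ⟨Y0, hY0⟩ | hN
    · obtain ⟨Y, h1, h2, hY⟩ := uu_window hm (uu_mem hm Y0) (X - m)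
      rw [← hY] at hY0
      by_cases hc : X < Y
      · refine ⟨- arc m (X+1) Y, ⟨Submodule.neg_mem _ (arc_mem hm _ _), fun z => ?_⟩, fun z => ?_⟩
        · simp only [Pi.neg_apply]
          rw [arc_inv hm hτ (by omega)]
          intro j h3 h4
          obtain ⟨j', h5, h6, h7⟩ := h.fwd X Y hY0 hc (by omega) j (by omega) h4
          exact ⟨j', by omega, h6, h7⟩
        · have h2 := arc_gamma hm (show X + 1 ≤ Y by omega) z
          rw [← gamma_uu hm X, eb_perm (gamma_inB hm)] at h2
          rw [hY0]
          simp only [Pi.neg_apply]; linarith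
      · refine ⟨arc m Y (X+1), ⟨arc_mem hm _ _, fun z => ?_⟩, fun z => ?_⟩
        · rw [arc_inv hm hτ (by omega)]
          intro j h3 h4
          obtain ⟨j', h5, h6, h7⟩ := h.bwd X Y hY0 (by omega) (by omega) j (by omega) (by omega)
          exact ⟨j', by omega, by omega, h7⟩
        · have h2 := arc_gamma hm (show Y ≤ X + 1 by omega) z
          rw [← gamma_uu hm X, eb_perm (gamma_inB hm)] at h2
          rw [hY0]
          linarith
    · refine ⟨half m (τ (uu m X)) (X + 1 - m), ⟨half_mem hm hN _, fun z => ?_⟩, fun z => half_gamma' hm hN X z⟩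
      apply half_inv hm hτ hN
      · intro j h1 h2
        rcases h.out X _ hN rfl j (by omega) (by omega) with h3 | ⟨j', h3, h4, h5⟩
        · exact Or.inl h3
        · exact Or.inr ⟨j', by omega, by omega, h5⟩
      · obtain ⟨v, h3, h4, h5⟩ := h.out' X _ hN rfl
        exact ⟨v, by omega, by omega, h5⟩
  · rcases signed_cases' (inB_mem hτ hx) with ⟨v, hv⟩ | hN'
    · refine ⟨half m x v, ⟨half_mem hm hN _, fun z => ?_⟩, fun z => by rw [half_gamma hm hN, hv]⟩
      exact half_inv hm hτ hN (h.inn v x hN hv) ⟨v, le_rfl, by omega, hv⟩ z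
    · rcases hN.eq_or hN' with h1 | h1
      · refine ⟨eb x, ⟨eb_mem hN.mem, fun z => ?_⟩, fun z => by rw [h1]⟩
        have := eb_perm hτ x z
        rwa [h1] at this
      · refine ⟨0, Submodule.zero_mem _, fun z => ?_⟩
        rw [h1, eb_neg_left, eb_N_gamma hm hN]; simp


noncomputable def HH (s : ℤ → ℤ) (p : ℤ) : ℤ := ∑ i ∈ Finset.Ico 0 p, s i - ∑ i ∈ Finset.Ico p 0, s i

lemma HH_zero (s : ℤ → ℤ) : HH s 0 = 0 := by simp [HH]

lemma HH_succ (s : ℤ → ℤ) (p : ℤ) : HH s (p+1) = HH s p + s p := by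
  unfold HH
  by_cases h : 0 ≤ p
  · rw [Finset.Ico_eq_empty (a := p) (by omega), Finset.Ico_eq_empty (a := p+1) (by omega)]
    have : Finset.Ico 0 (p+1) = insert p (Finset.Ico 0 p) := by
      ext x; simp only [Finset.mem_insert, Finset.mem_Ico]; omega
    rw [this, Finset.sum_insert (by simp)]; simp; ring
  · rw [Finset.Ico_eq_empty (b := p) (by omega), Finset.Ico_eq_empty (b := p+1) (by omega)]
    have : Finset.Ico p 0 = insert p (Finset.Ico (p+1) 0) := by
      ext x; simp only [Finset.mem_insert, Finset.mem_Ico]; omega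
    rw [this, Finset.sum_insert (by simp)]; simp

/-- matched pairs -/
def MM (s : ℤ → ℤ) (p q : ℤ) : Prop :=
  p < q ∧ HH s (q+1) = HH s p ∧ ∀ r, p < r → r ≤ q → HH s p < HH s r

def UU (s : ℤ → ℤ) (p : ℤ) : Prop := ∀ r, p < r → HH s p < HH s r

lemma MM_unique_right {s : ℤ → ℤ} {p q q' : ℤ} (h : MM s p q) (h' : MM s p q') : q = q' := by
  obtain ⟨h1, h2, h3⟩ := h
  obtain ⟨h1', h2', h3'⟩ := h'
  rcases lt_trichotomy q q' with h | h | h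
  · have := h3' (q+1) (by omega) (by omega); omega
  · exact h
  · have := h3 (q'+1) (by omega) (by omega); omega

lemma MM_unique_left {s : ℤ → ℤ} {p p' q : ℤ} (h : MM s p q) (h' : MM s p' q) : p = p' := by
  obtain ⟨h1, h2, h3⟩ := h
  obtain ⟨h1', h2', h3'⟩ := h'
  rcases lt_trichotomy p p' with h | h | h
  · have := h3 p' (by omega) (by omega); omega
  · exact h
  · have := h3' p (by omega) (by omega); omega

lemma MM_left {s : ℤ → ℤ} (hs : ∀ p, s p = 1 ∨ s p = -1) {p q : ℤ} (h : MM s p q) : s p = 1 := by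
  obtain ⟨h1, h2, h3⟩ := h
  have := h3 (p+1) (by omega) (by omega)
  rw [HH_succ] at this
  rcases hs p with h | h <;> omega

lemma MM_right {s : ℤ → ℤ} (hs : ∀ p, s p = 1 ∨ s p = -1) {p q : ℤ} (h : MM s p q) : s q = -1 := by
  obtain ⟨h1, h2, h3⟩ := h
  have := h3 q (by omega) (by omega)
  rw [HH_succ] at h2
  rcases hs q with h | h <;> omega

lemma UU_left {s : ℤ → ℤ} (hs : ∀ p, s p = 1 ∨ s p = -1) {p : ℤ} (h : UU s p) : s p = 1 := by
  have := h (p+1) (by omega)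
  rw [HH_succ] at this
  rcases hs p with h | h <;> omega

lemma HH_parity {s : ℤ → ℤ} (hs : ∀ p, s p = 1 ∨ s p = -1) (p : ℤ) : HH s p % 2 = p % 2 := by
  induction p using Int.induction_on with
  | zero => simp [HH_zero]
  | succ i ih => rw [HH_succ]; rcases hs i with h | h <;> omega
  | pred i ih =>
    have := HH_succ s (-(i:ℤ) - 1)
    rw [sub_add_cancel] at this
    rcases hs (-(i:ℤ) - 1) with h | h <;> omega

lemma MM_parity {s : ℤ → ℤ} (hs : ∀ p, s p = 1 ∨ s p = -1) {p q : ℤ} (h : MM s p q) :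
    (q - p) % 2 = 1 := by
  have h1 := HH_parity hs (q+1)
  have h2 := HH_parity hs p
  have := h.2.1
  omega

lemma MM_of_PR {s : ℤ → ℤ} (hs : ∀ p, s p = 1 ∨ s p = -1) (PR : ℤ → ℤ → Prop)
    (h0 : ∀ p q, PR p q → p < q) (h1 : ∀ p q, PR p q → s p = 1) (h2 : ∀ p q, PR p q → s q = -1)
    (h3 : ∀ p q, PR p q → ∀ r, p < r → r < q → ∃ r', p < r' ∧ r' < q ∧ (PR r r' ∨ PR r' r)) :
    ∀ (n : ℕ) (p q : ℤ), q - p < n → PR p q → MM s p q := by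
  intro n
  induction n with
  | zero => intro p q h hp; have := h0 p q hp; push_cast at h; omega
  | succ n ih =>
    intro p q hn hp
    have hpq := h0 p q hp
    have A : ∀ k : ℕ, ∀ r, r = p + 1 + k → r ≤ q → HH s (p+1) ≤ HH s r := by
      intro k
      induction k using Nat.strong_induction_on with
      | _ k ihk =>
        intro r hr hrq
        rcases Nat.eq_zero_or_pos k with hk | hk
        · subst hk; simp at hr; rw [hr]
        · have e : r - 1 + 1 = r := by ring
          have e2 := HH_succ s (r-1)
          rw [e] at e2
          rcases hs (r-1) with h | h
          · have := ihk (k-1) (by omega) (r-1) (by omega) (by omega)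
            omega
          · obtain ⟨r', h5, h6, h7⟩ := h3 p q hp (r-1) (by omega) (by omega)
            rcases h7 with h7 | h7
            · have := h1 _ _ h7; omega
            · have h8 := h0 _ _ h7
              have h9 := ih r' (r-1) (by push_cast at hn; omega) h7
              have h10 := h9.2.1
              rw [e] at h10
              have := ihk (r' - p - 1).toNat (by omega) r' (by omega) (by omega)
              omega
    have B : ∀ k : ℕ, ∀ r, r = q - k → p < r → HH s q ≤ HH s r := by
      intro k
      induction k using Nat.strong_induction_on with
      | _ k ihk =>
        intro r hr hrq
        rcases Nat.eq_zero_or_pos k with hk | hk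
        · subst hk; simp at hr; rw [hr]
        · have e2 := HH_succ s r
          rcases hs r with h | h
          · obtain ⟨r', h5, h6, h7⟩ := h3 p q hp r (by omega) (by omega)
            rcases h7 with h7 | h7
            · have h8 := h0 _ _ h7
              have h9 := ih r r' (by push_cast at hn; omega) h7
              have h10 := h9.2.1
              have := ihk (q - (r'+1)).toNat (by omega) (r'+1) (by omega) (by omega)
              omega
            · have := h2 _ _ h7; omega
          · have := ihk (k-1) (by omega) (r+1) (by omega) (by omega)
            omega
    have hp1 := HH_succ s p
    have hq1 := HH_succ s q
    rw [h1 p q hp] at hp1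
    rw [h2 p q hp] at hq1
    have a := A (q - (p+1)).toNat q (by omega) le_rfl
    have b := B (q - (p+1)).toNat (p+1) (by omega) (by omega)
    refine ⟨hpq, by omega, fun r hr1 hr2 => ?_⟩
    have := A (r - (p+1)).toNat r (by omega) hr2
    omega

structure Per (m : ℕ) (s : ℤ → ℤ) (S : ℤ) : Prop where
  pm : ∀ p, s p = 1 ∨ s p = -1
  per : ∀ p, s (p + 2 * m) = s p
  sh : HH s (2 * m) = S
  S02 : S = 0 ∨ S = 2

lemma Per.H1 {m : ℕ} {s : ℤ → ℤ} {S : ℤ} (h : Per m s S) (p : ℤ) : HH s (p + 2 * m) = HH s p + S := by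
  induction p using Int.induction_on with
  | zero => rw [zero_add, h.sh, HH_zero, zero_add]
  | succ i ih =>
    rw [HH_succ, show (i:ℤ) + 1 + 2 * m = (i + 2 * m) + 1 by ring, HH_succ, h.per, ih]; ring
  | pred i ih =>
    have h1 := HH_succ s (-(i:ℤ) - 1)
    have h2 := HH_succ s (-(i:ℤ) - 1 + 2 * m)
    rw [show -(i:ℤ) - 1 + 2 * m + 1 = -(i:ℤ) + 2 * m by ring, h.per] at h2
    rw [sub_add_cancel] at h1
    omega

lemma Per.Hk {m : ℕ} {s : ℤ → ℤ} {S : ℤ} (h : Per m s S) (p k : ℤ) :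
    HH s (p + 2 * m * k) = HH s p + S * k := by
  induction k using Int.induction_on with
  | zero => simp
  | succ i ih =>
    rw [show p + 2 * m * ((i:ℤ) + 1) = (p + 2 * m * i) + 2 * m by ring, h.H1, ih]; ring
  | pred i ih =>
    have := h.H1 (p + 2 * m * (-(i:ℤ) - 1))
    rw [show p + 2 * m * (-(i:ℤ) - 1) + 2 * m = p + 2 * m * (-(i:ℤ)) by ring, ih] at this
    linarith

lemma Per.MMk {m : ℕ} {s : ℤ → ℤ} {S : ℤ} (h : Per m s S) {p q : ℤ} (k : ℤ) (hM : MM s p q) :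
    MM s (p + 2 * m * k) (q + 2 * m * k) := by
  obtain ⟨h1, h2, h3⟩ := hM
  refine ⟨by omega, ?_, fun r hr1 hr2 => ?_⟩
  · rw [show q + 2 * m * k + 1 = q + 1 + 2 * m * k by ring, h.Hk, h.Hk, h2]
  · have := h3 (r - 2 * m * k) (by omega) (by omega)
    have e := h.Hk (r - 2 * m * k) k
    rw [sub_add_cancel] at e
    rw [e, h.Hk]; omega

lemma Per.UUk {m : ℕ} {s : ℤ → ℤ} {S : ℤ} (h : Per m s S) {p : ℤ} (k : ℤ) (hM : UU s p) :
    UU s (p + 2 * m * k) := by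
  intro r hr1
  have := hM (r - 2 * m * k) (by omega)
  have e := h.Hk (r - 2 * m * k) k
  rw [sub_add_cancel] at e
  rw [e, h.Hk]; omega

lemma Per.span {m : ℕ} {s : ℤ → ℤ} {S : ℤ} (h : Per m s S) (hm : 0 < m) {p q : ℤ} (hM : MM s p q) :
    q - p ≤ 2 * m - 1 := by
  obtain ⟨h1, h2, h3⟩ := hM
  by_contra hc
  have := h3 (q + 1 - 2 * m) (by omega) (by omega)
  have e := h.H1 (q + 1 - 2 * m)
  rw [sub_add_cancel] at e
  rcases h.S02 with h | h <;> omega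

lemma least_int {P : ℤ → Prop} {b : ℤ} (hb : ∀ r, P r → b ≤ r) (h : ∃ r, P r) :
    ∃ r, P r ∧ ∀ r', P r' → r ≤ r' := by
  classical
  obtain ⟨r, h1, h2⟩ := Int.exists_least_of_bdd ⟨b, hb⟩ h
  exact ⟨r, h1, h2⟩

lemma greatest_int {P : ℤ → Prop} {b : ℤ} (hb : ∀ r, P r → r ≤ b) (h : ∃ r, P r) :
    ∃ r, P r ∧ ∀ r', P r' → r' ≤ r := by
  classical
  obtain ⟨r, h1, h2⟩ := Int.exists_greatest_of_bdd ⟨b, hb⟩ h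
  exact ⟨r, h1, h2⟩

lemma Per.closer {m : ℕ} {s : ℤ → ℤ} {S : ℤ} (h : Per m s S) (hm : 0 < m) {q : ℤ} (hq : s q = -1) :
    ∃ p, MM s p q := by
  have e := HH_succ s q
  rw [hq] at e
  obtain ⟨r, ⟨h1, h2⟩, h3⟩ := greatest_int (P := fun r => r ≤ q ∧ HH s r ≤ HH s (q+1)) (b := q)
    (fun r hr => hr.1) ⟨q + 1 - 2 * m, by omega, by
      have e := h.H1 (q + 1 - 2 * m)
      rw [sub_add_cancel] at e
      rcases h.S02 with h | h <;> omega⟩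
  have hrq : r < q := by
    rcases lt_or_eq_of_le h1 with h | h
    · exact h
    · rw [h] at h2; omega
  have h4 : ∀ r', r < r' → r' ≤ q → HH s (q+1) < HH s r' := by
    intro r' h5 h6
    by_contra hc
    have := h3 r' ⟨h6, by omega⟩
    omega
  have h5 := h4 (r+1) (by omega) (by omega)
  have e' := HH_succ s r
  have : HH s r = HH s (q+1) := by
    rcases h.pm r with h | h <;> omega
  exact ⟨r, hrq, this.symm, by rw [this]; exact h4⟩

lemma Per.opener {m : ℕ} {s : ℤ → ℤ} {S : ℤ} (h : Per m s S) {p : ℤ} (hp : s p = 1) :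
    (∃ q, MM s p q) ∨ UU s p := by
  by_cases hU : UU s p
  · exact Or.inr hU
  left
  unfold UU at hU
  push Not at hU
  obtain ⟨r, ⟨h1, h2⟩, h3⟩ := least_int (P := fun r => p < r ∧ HH s r ≤ HH s p) (b := p)
    (fun r hr => by omega) hU
  have e := HH_succ s p
  rw [hp] at e
  have hrp : r ≠ p + 1 := by intro hr; rw [hr] at h2; omega
  have h4 : ∀ r', p < r' → r' < r → HH s p < HH s r' := by
    intro r' h5 h6
    by_contra hc
    have := h3 r' ⟨h5, by omega⟩
    omega
  have h5 := h4 (r-1) (by omega) (by omega)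
  have e' := HH_succ s (r-1)
  rw [sub_add_cancel] at e'
  refine ⟨r-1, by omega, ?_, fun r' h6 h7 => h4 r' h6 (by omega)⟩
  rw [sub_add_cancel]
  rcases h.pm (r-1) with h | h <;> omega

def PM (s : ℤ → ℤ) (p q : ℤ) : Prop := MM s p q ∨ MM s q p

lemma PM.symm {s : ℤ → ℤ} {p q : ℤ} (h : PM s p q) : PM s q p := Or.symm h

lemma Per.tri {m : ℕ} {s : ℤ → ℤ} {S : ℤ} (h : Per m s S) (hm : 0 < m) (p : ℤ) :
    (∃ q, PM s p q) ∨ UU s p := by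
  rcases h.pm p with hp | hp
  · rcases h.opener hp with ⟨q, hq⟩ | hU
    · exact Or.inl ⟨q, Or.inl hq⟩
    · exact Or.inr hU
  · obtain ⟨q, hq⟩ := h.closer hm hp
    exact Or.inl ⟨q, Or.inr hq⟩

lemma PM_unique {s : ℤ → ℤ} (hs : ∀ p, s p = 1 ∨ s p = -1) {p q q' : ℤ} (h : PM s p q) (h' : PM s p q') :
    q = q' := by
  rcases h with h | h <;> rcases h' with h' | h'
  · exact MM_unique_right h h'
  · have := MM_left hs h; have := MM_right hs h'; omega
  · have := MM_left hs h'; have := MM_right hs h; omega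
  · exact MM_unique_left h h'

lemma MM_UU {s : ℤ → ℤ} {p q u : ℤ} (h : MM s p q) (hu : UU s u) : u < p ∨ q < u := by
  by_contra! hc
  obtain ⟨h1, h2, h3⟩ := h
  have h4 := hu (q+1) (by omega)
  rcases eq_or_lt_of_le hc.1 with h5 | h5
  · subst h5; omega
  · have := h3 u h5 hc.2; omega

lemma PM_UU_lt {s : ℤ → ℤ} {p q u : ℤ} (h : PM s p q) (hu : UU s u) (hp : p ≤ u) : q < u := by
  rcases h with h | h
  · rcases MM_UU h hu with h1 | h1
    · omega
    · exact h1
  · have := h.1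
    rcases MM_UU h hu with h1 | h1 <;> omega

lemma PM_UU_gt {s : ℤ → ℤ} {p q u : ℤ} (h : PM s p q) (hu : UU s u) (hp : u ≤ p) : u < q := by
  rcases h with h | h
  · rcases MM_UU h hu with h1 | h1
    · exact h1.trans h.1
    · have := h.1; omega
  · rcases MM_UU h hu with h1 | h1
    · exact h1
    · omega

lemma PM_not_UU {s : ℤ → ℤ} {p q : ℤ} (h : PM s p q) : ¬ UU s p := by
  intro hu
  have := PM_UU_lt h hu le_rfl
  have := PM_UU_gt h hu le_rfl
  omega

lemma Per.inside {m : ℕ} {s : ℤ → ℤ} {S : ℤ} (h : Per m s S) (hm : 0 < m) {p q r : ℤ} (hM : MM s p q)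
    (h1 : p < r) (h2 : r < q) : ∃ r', p < r' ∧ r' < q ∧ PM s r r' := by
  obtain ⟨h3, h4, h5⟩ := hM
  have h6 := h5 r h1 h2.le
  rcases h.tri hm r with ⟨r', hr | hr⟩ | hU
  · refine ⟨r', h1.trans hr.1, ?_, Or.inl hr⟩
    by_contra hc
    rcases eq_or_lt_of_le (not_lt.1 hc) with h7 | h7
    · have := hr.2.1; rw [← h7] at this; omega
    · have := hr.2.2 (q+1) (by omega) (by omega); omega
  · refine ⟨r', ?_, hr.1.trans h2, Or.inr hr⟩
    have h8 := h5 (r+1) (by omega) (by omega)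
    have h9 := hr.2.1
    by_contra hc
    rcases eq_or_lt_of_le (not_lt.1 hc) with h7 | h7
    · rw [h7] at h9; omega
    · have := hr.2.2 p (by omega) (by omega); omega
  · have := hU (q+1) (by omega); omega

lemma Per.U_S {m : ℕ} {s : ℤ → ℤ} {S : ℤ} (h : Per m s S) (hm : 0 < m) {p : ℤ} (hU : UU s p) : S = 2 := by
  have := hU (p + 2 * m) (by omega)
  rw [h.H1] at this
  rcases h.S02 with h | h <;> omega

lemma U_inj {s : ℤ → ℤ} {p p' : ℤ} (h : UU s p) (h' : UU s p') (he : HH s p = HH s p') : p = p' := by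
  rcases lt_trichotomy p p' with h1 | h1 | h1
  · have := h _ h1; omega
  · exact h1
  · have := h' _ h1; omega

lemma U_mono {s : ℤ → ℤ} {p p' : ℤ} (h' : UU s p') (he : HH s p < HH s p') : p < p' := by
  rcases lt_trichotomy p p' with h1 | h1 | h1
  · exact h1
  · subst h1; omega
  · have := h' _ h1; omega

lemma Per.H_lower {m : ℕ} {s : ℤ → ℤ} (h : Per m s 2) (hm : 0 < m) (c : ℤ) :
    ∃ b, ∀ r, HH s r ≤ c → r ≤ b := by
  have hb : ∀ p : ℕ, -(p:ℤ) ≤ HH s p := by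
    intro p
    induction p with
    | zero => simp [HH_zero]
    | succ p ih =>
      push_cast
      rw [HH_succ]
      rcases h.pm p with h | h <;> omega
  refine ⟨2 * m * (|c| + 2 * m + 1), fun r hr => ?_⟩
  obtain ⟨t, k, rfl, h0, h1⟩ := red2 hm r
  rw [h.Hk] at hr
  lift t to ℕ using h0
  have := hb t
  have hc1 := le_abs_self c
  have hc2 := abs_nonneg c
  have hk : k ≤ |c| + 2 * m := by omega
  nlinarith

lemma Per.U_exists {m : ℕ} {s : ℤ → ℤ} (h : Per m s 2) (hm : 0 < m) (c : ℤ) :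
    ∃ p, UU s p ∧ HH s p = c := by
  obtain ⟨b, hb⟩ := h.H_lower hm c
  obtain ⟨p, h1, h2⟩ := greatest_int (P := fun r => HH s r ≤ c) hb ⟨2 * m * (- |c|), by
    have := h.Hk 0 (-|c|)
    rw [zero_add, HH_zero] at this
    rw [this]
    have := neg_abs_le c
    have := abs_nonneg c
    omega⟩
  have h3 : ∀ r, p < r → c < HH s r := by
    intro r hr
    by_contra hc
    have := h2 r (by omega)
    omega
  have e := HH_succ s p
  have h4 := h3 (p+1) (by omega)
  have h5 : HH s p = c := by rcases h.pm p with h | h <;> omega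
  exact ⟨p, fun r hr => by rw [h5]; exact h3 r hr, h5⟩


def Lk (m : ℕ) (τ : Equiv.Perm ℤ) (X Y : ℤ) : Prop :=
  τ (uu m X) = uu m Y ∧ X - m < Y ∧ Y ≤ X + m

def PR (m : ℕ) (τ : Equiv.Perm ℤ) (p q : ℤ) : Prop :=
  p < q ∧ ∃ X Y, Lk m τ X Y ∧ ((p = 2 * X + 1 ∧ q = 2 * Y) ∨ (p = 2 * Y ∧ q = 2 * X + 1))

open Classical in
noncomputable def sg (m : ℕ) (τ : Equiv.Perm ℤ) (p : ℤ) : ℤ := if ∃ p', PR m τ p' p then -1 else 1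

lemma Lk_shift1 {m : ℕ} (hm : 0 < m) {τ : Equiv.Perm ℤ} (hτ : inB (m+1) τ) {X Y : ℤ} :
    Lk m τ (X + m) (Y + m) ↔ Lk m τ X Y := by
  unfold Lk
  rw [uu_neg hm, uu_neg hm, hτ.1, neg_inj]
  constructor <;> rintro ⟨h1, h2, h3⟩ <;> exact ⟨h1, by omega, by omega⟩

lemma Lk_shift {m : ℕ} (hm : 0 < m) {τ : Equiv.Perm ℤ} (hτ : inB (m+1) τ) {X Y : ℤ} (k : ℤ)
    (h : Lk m τ X Y) : Lk m τ (X + m * k) (Y + m * k) := by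
  induction k using Int.induction_on with
  | zero => simpa using h
  | succ i ih =>
    have := (Lk_shift1 hm hτ).2 ih
    convert this using 1 <;> ring
  | pred i ih =>
    apply (Lk_shift1 hm hτ).1
    convert ih using 1 <;> ring

lemma PR_shift {m : ℕ} (hm : 0 < m) {τ : Equiv.Perm ℤ} (hτ : inB (m+1) τ) {p q : ℤ} (k : ℤ)
    (h : PR m τ p q) : PR m τ (p + 2 * m * k) (q + 2 * m * k) := by
  obtain ⟨h1, X, Y, h2, h3⟩ := h
  refine ⟨by omega, _, _, Lk_shift hm hτ k h2, ?_⟩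
  rcases h3 with ⟨rfl, rfl⟩ | ⟨rfl, rfl⟩
  · left; constructor <;> ring
  · right; constructor <;> ring

lemma sg_pm (m : ℕ) (τ : Equiv.Perm ℤ) (p : ℤ) : sg m τ p = 1 ∨ sg m τ p = -1 := by
  unfold sg; split_ifs <;> simp

lemma sg_neg {m : ℕ} {τ : Equiv.Perm ℤ} {p : ℤ} : sg m τ p = -1 ↔ ∃ p', PR m τ p' p := by
  unfold sg; split_ifs with h <;> simp [h]

lemma sg_per {m : ℕ} (hm : 0 < m) {τ : Equiv.Perm ℤ} (hτ : inB (m+1) τ) (p k : ℤ) :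
    sg m τ (p + 2 * m * k) = sg m τ p := by
  have : (∃ p', PR m τ p' (p + 2 * m * k)) ↔ ∃ p', PR m τ p' p := by
    constructor
    · rintro ⟨p', h⟩
      have := PR_shift hm hτ (-k) h
      rw [show p + 2 * m * k + 2 * m * -k = p by ring] at this
      exact ⟨_, this⟩
    · rintro ⟨p', h⟩
      exact ⟨_, PR_shift hm hτ k h⟩
  unfold sg
  exact @if_congr _ _ _ (Classical.propDecidable _) (Classical.propDecidable _) _ _ _ _ this rfl rfl

lemma Lk_right {m : ℕ} (hm : 0 < m) {τ : Equiv.Perm ℤ} {X Y Y' : ℤ} (h : Lk m τ X Y) (h' : Lk m τ X Y') :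
    Y = Y' := by
  obtain ⟨h1, h2, h3⟩ := h
  obtain ⟨h1', h2', h3'⟩ := h'
  exact uu_inj_lt hm (h1.symm.trans h1') (by omega) (by omega)

lemma Lk_left {m : ℕ} (hm : 0 < m) {τ : Equiv.Perm ℤ} {X X' Y : ℤ} (h : Lk m τ X Y) (h' : Lk m τ X' Y) :
    X = X' := by
  obtain ⟨h1, h2, h3⟩ := h
  obtain ⟨h1', h2', h3'⟩ := h'
  exact uu_inj_lt hm (τ.injective (h1.trans h1'.symm)) (by omega) (by omega)

lemma Lk_of_eq {m : ℕ} (hm : 0 < m) {τ : Equiv.Perm ℤ} {X Y : ℤ} (h : τ (uu m X) = uu m Y) :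
    ∃ Y', uu m Y' = uu m Y ∧ Lk m τ X Y' := by
  obtain ⟨Y', h1, h2, h3⟩ := uu_window hm (uu_mem hm Y) (X - m)
  exact ⟨Y', h3, h.trans h3.symm, h1, by omega⟩

lemma PR_not_both {m : ℕ} (hm : 0 < m) {τ : Equiv.Perm ℤ} {r p q : ℤ} (h : PR m τ r p) (h' : PR m τ p q) :
    False := by
  obtain ⟨h1, X, Y, h2, h3⟩ := h
  obtain ⟨h1', X', Y', h2', h3'⟩ := h'
  rcases h3 with ⟨h3, h4⟩ | ⟨h3, h4⟩ <;> rcases h3' with ⟨h3', h4'⟩ | ⟨h3', h4'⟩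
  · omega
  · have : Y = Y' := by omega
    subst this
    have := Lk_left hm h2 h2'; omega
  · have : X = X' := by omega
    subst this
    have := Lk_right hm h2 h2'; omega
  · omega

lemma PR_inside {m : ℕ} (hm : 0 < m) {τ : Equiv.Perm ℤ} (h : Nonc m τ) {p q r : ℤ} (hp : PR m τ p q)
    (h1 : p < r) (h2 : r < q) : ∃ r', p < r' ∧ r' < q ∧ (PR m τ r r' ∨ PR m τ r' r) := by
  have key : ∀ j j', Lk m τ j j' → PR m τ (2*j+1) (2*j') ∨ PR m τ (2*j') (2*j+1) := by
    intro j j' hj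
    rcases lt_or_gt_of_ne (show 2*j+1 ≠ 2*j' by omega) with h | h
    · exact Or.inl ⟨h, j, j', hj, Or.inl ⟨rfl, rfl⟩⟩
    · exact Or.inr ⟨h, j, j', hj, Or.inr ⟨rfl, rfl⟩⟩
  obtain ⟨h0, X, Y, ⟨hL, hl1, hl2⟩, ⟨rfl, rfl⟩ | ⟨rfl, rfl⟩⟩ := hp
  · have hf := h.fwd X Y hL (by omega) hl2
    rcases Int.even_or_odd' r with ⟨j, rfl | rfl⟩
    · obtain ⟨y, hy, hy2⟩ := closed_pre (τ := τ) (S := (Finset.Ioo X Y).image (uu m)) (by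
        intro y hy
        simp only [Finset.mem_image, Finset.mem_Ioo] at hy ⊢
        obtain ⟨j, ⟨h1, h2⟩, rfl⟩ := hy
        obtain ⟨j', h3, h4, h5⟩ := hf j h1 h2
        exact ⟨j', ⟨h3, h4⟩, h5.symm⟩) (y := uu m j)
        (Finset.mem_image_of_mem _ (Finset.mem_Ioo.2 ⟨by omega, by omega⟩))
      simp only [Finset.mem_image, Finset.mem_Ioo] at hy
      obtain ⟨i, ⟨h3, h4⟩, rfl⟩ := hy
      exact ⟨2*i+1, by omega, by omega, (key i j ⟨hy2, by omega, by omega⟩).symm⟩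
    · obtain ⟨j', h3, h4, h5⟩ := hf j (by omega) (by omega)
      exact ⟨2*j', by omega, by omega, key j j' ⟨h5, by omega, by omega⟩⟩
  · have hf := h.bwd X Y hL (by omega) (by omega)
    rcases Int.even_or_odd' r with ⟨j, rfl | rfl⟩
    · obtain ⟨y, hy, hy2⟩ := closed_pre (τ := τ) (S := (Finset.Icc Y X).image (uu m)) (by
        intro y hy
        simp only [Finset.mem_image, Finset.mem_Icc] at hy ⊢
        obtain ⟨j, ⟨h1, h2⟩, rfl⟩ := hy
        obtain ⟨j', h3, h4, h5⟩ := hf j h1 h2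
        exact ⟨j', ⟨h3, h4⟩, h5.symm⟩) (y := uu m j)
        (Finset.mem_image_of_mem _ (Finset.mem_Icc.2 ⟨by omega, by omega⟩))
      simp only [Finset.mem_image, Finset.mem_Icc] at hy
      obtain ⟨i, ⟨h3, h4⟩, rfl⟩ := hy
      have hL' : Lk m τ i j := ⟨hy2, by omega, by omega⟩
      have : i ≠ X := by
        rintro rfl
        have := Lk_right hm hL' ⟨hL, hl1, hl2⟩; omega
      exact ⟨2*i+1, by omega, by omega, (key i j hL').symm⟩
    · obtain ⟨j', h3, h4, h5⟩ := hf j (by omega) (by omega)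
      have hL' : Lk m τ j j' := ⟨h5, by omega, by omega⟩
      have : j' ≠ Y := by
        rintro rfl
        have := Lk_left hm hL' ⟨hL, hl1, hl2⟩; omega
      exact ⟨2*j', by omega, by omega, key j j' hL'⟩

lemma PR_MM {m : ℕ} (hm : 0 < m) {τ : Equiv.Perm ℤ} (h : Nonc m τ) {p q : ℤ} (hp : PR m τ p q) :
    MM (sg m τ) p q := by
  refine MM_of_PR (sg_pm m τ) (PR m τ) (fun p q h => h.1) ?_ (fun p q h => sg_neg.2 ⟨p, h⟩)
    (fun p q h' r h1 h2 => PR_inside hm h h' h1 h2) ((q - p).toNat + 1) p q (by omega) hp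
  intro p q hpq
  rcases sg_pm m τ p with h1 | h1
  · exact h1
  · obtain ⟨r, hr⟩ := sg_neg.1 h1
    exact (PR_not_both hm hr hpq).elim

lemma PR_transfer {m : ℕ} (hm : 0 < m) {τ σ : Equiv.Perm ℤ} (h : Nonc m τ) (h' : Nonc m σ)
    (hs : sg m τ = sg m σ) {p q : ℤ} (hp : PR m τ p q) : PR m σ p q := by
  have h1 := PR_MM hm h hp
  obtain ⟨p', hp'⟩ := sg_neg.1 ((congrFun hs q).symm.trans (sg_neg.2 ⟨p, hp⟩))
  have h2 := PR_MM hm h' hp'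
  rw [← hs] at h2
  rwa [MM_unique_left h1 h2]

lemma Lk_transfer {m : ℕ} (hm : 0 < m) {τ σ : Equiv.Perm ℤ} (h : Nonc m τ) (h' : Nonc m σ)
    (hs : sg m τ = sg m σ) {X Y : ℤ} (hp : Lk m τ X Y) : Lk m σ X Y := by
  rcases lt_or_gt_of_ne (show 2*X+1 ≠ 2*Y by omega) with hl | hl
  · obtain ⟨_, X', Y', h2, h3⟩ := PR_transfer hm h h' hs ⟨hl, X, Y, hp, Or.inl ⟨rfl, rfl⟩⟩
    have : X' = X ∧ Y' = Y := by omega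
    rwa [this.1, this.2] at h2
  · obtain ⟨_, X', Y', h2, h3⟩ := PR_transfer hm h h' hs ⟨hl, X, Y, hp, Or.inr ⟨rfl, rfl⟩⟩
    have : X' = X ∧ Y' = Y := by omega
    rwa [this.1, this.2] at h2

lemma uu_eq_neg {m : ℕ} (hm : 0 < m) {x y : ℤ} (h : uu m x = uu m y ∨ uu m x = - uu m y) (h1 : x - y < m)
    (h2 : y - x < m) : x = y := by
  rcases h with h | h
  · exact uu_inj_lt hm h (by omega) (by omega)
  · rw [← uu_neg hm] at h
    have := uu_inj_lt hm h (by omega) (by omega)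
    omega

/-- same data gives the same images -/
lemma phi_inj {m : ℕ} (hm : 0 < m) {τ σ : Equiv.Perm ℤ} (h : Nonc m τ) (h' : Nonc m σ)
    (hs : sg m τ = sg m σ) (he : 0 < τ ((m:ℤ)+1) ↔ 0 < σ ((m:ℤ)+1)) : τ = σ := by
  have htop : IsN m ((m:ℤ)+1) := Or.inl rfl
  have hτ := h.inb
  have hσ := h'.inb
  have heN : ∀ N, IsN m N → τ N = - σ N → False := by
    have : τ ((m:ℤ)+1) ≠ - σ ((m:ℤ)+1) := by
      intro h1
      have h2 := (mem_signedSet.1 (inB_mem hσ htop.mem)).1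
      omega
    rintro N (rfl | rfl) h2
    · exact this h2
    · rw [hτ.1, hσ.1] at h2; omega
  -- key lemma on unlinked points
  have key : ∀ X N, IsN m N → τ (uu m X) = N → σ (uu m X) = N ∧ σ N = τ N := by
    intro X N hN hX
    obtain ⟨v, hv1, hv2, hv3⟩ := h.out' X N hN hX
    rcases signed_cases' (inB_mem hσ (uu_mem' hm X)) with ⟨Y, hY⟩ | hN'
    · obtain ⟨Y', -, hL⟩ := Lk_of_eq hm hY
      have := (Lk_transfer hm h' h hs.symm hL).1
      rw [hX] at this
      exact absurd this (hN.ne_uu hm _)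
    · obtain ⟨v', hv1', hv2', hv3'⟩ := h'.out' X _ hN' rfl
      -- v' is an unlinked target for τ
      have hpre : ∃ z, IsN m z ∧ τ z = uu m v' := by
        refine ⟨τ⁻¹ (uu m v'), ?_, by simp⟩
        rcases signed_cases' (inB_mem (inB_inv hτ) (uu_mem' hm v')) with ⟨Z, hZ⟩ | hz
        · have : τ (uu m Z) = uu m v' := by rw [← hZ]; simp
          have hL : ∃ Z', Lk m τ Z' v' := by
            obtain ⟨Z', h1, h2, h3⟩ := uu_window hm (uu_mem hm Z) (v' - m - 1)
            exact ⟨Z', by rw [h3]; exact this, by omega, by omega⟩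
          obtain ⟨Z', hL⟩ := hL
          have h4 := (Lk_transfer hm h h' hs hL).1
          have := σ.injective (h4.trans hv3'.symm)
          exact absurd this.symm (hN'.ne_uu hm _)
        · exact hz
      obtain ⟨z, hz, hz2⟩ := hpre
      have hvv : v' = v := by
        apply uu_eq_neg hm _ (by omega) (by omega)
        rcases hN.eq_or hz with rfl | rfl
        · left; rw [← hz2, hv3]
        · right; rw [← hz2, hτ.1, hv3]
      subst hvv
      rcases hN.eq_or hN' with h1 | h1
      · rw [h1] at hv3'
        exact ⟨h1, by rw [hv3, hv3']⟩
      · rw [h1, hσ.1] at hv3'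
        exact (heN N hN (by rw [hv3, hv3'])).elim
  have houter : ∀ X, τ (uu m X) = σ (uu m X) := by
    intro X
    rcases signed_cases' (inB_mem hτ (uu_mem' hm X)) with ⟨Y, hY⟩ | hN
    · obtain ⟨Y', h1, hL⟩ := Lk_of_eq hm hY
      rw [(Lk_transfer hm h h' hs hL).1, h1, hY]
    · exact (key X _ hN rfl).1.symm
  have hinner : ∀ N, IsN m N → τ N = σ N := by
    intro N hN
    by_cases hx : ∃ X, IsN m (τ (uu m X))
    · obtain ⟨X, hX⟩ := hx
      have := (key X _ hX rfl).2
      rcases hX.eq_or hN with rfl | rfl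
      · exact this.symm
      · rw [hτ.1, hσ.1, this]
    · push Not at hx
      have h3 : IsN m (τ N) := by
        rcases signed_cases' (inB_mem hτ hN.mem) with ⟨v, hv⟩ | h3
        · -- inner goes to outer: then closedness gives a preimage of N
          exfalso
          obtain ⟨y, hy, hy2⟩ : ∃ y, y ∈ signedSet (m+1) ∧ τ y = N :=
            ⟨τ⁻¹ N, inB_mem (inB_inv hτ) hN.mem, by simp⟩
          rcases signed_cases' hy with ⟨Y, rfl⟩ | hy3
          · exact hx Y (by rw [hy2]; exact hN)
          · rcases hN.eq_or hy3 with rfl | rfl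
            · exact hN.ne_uu hm v (hy2.symm.trans hv)
            · rw [hτ.1, hv, ← uu_neg hm] at hy2
              exact hN.ne_uu hm _ hy2.symm
        · exact h3
      have h4 : IsN m (σ N) := by
        rcases signed_cases' (inB_mem hσ hN.mem) with ⟨v, hv⟩ | h3
        · exfalso
          obtain ⟨y, hy, hy2⟩ : ∃ y, y ∈ signedSet (m+1) ∧ σ y = N :=
            ⟨σ⁻¹ N, inB_mem (inB_inv hσ) hN.mem, by simp⟩
          rcases signed_cases' hy with ⟨Y, rfl⟩ | hy3
          · exact hx Y (by rw [houter, hy2]; exact hN)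
          · rcases hN.eq_or hy3 with rfl | rfl
            · exact hN.ne_uu hm v (hy2.symm.trans hv)
            · rw [hσ.1, hv, ← uu_neg hm] at hy2
              exact hN.ne_uu hm _ hy2.symm
        · exact h3
      rcases h4.eq_or h3 with h5 | h5
      · exact h5
      · exact (heN N hN h5).elim
  ext z
  by_cases hz : z ∈ signedSet (m+1)
  · rcases signed_cases' hz with ⟨X, rfl⟩ | hN
    · exact houter X
    · exact hinner z hN
  · rw [hτ.2 z hz, hσ.2 z hz]


noncomputable def AA (m : ℕ) (τ : Equiv.Perm ℤ) : Finset ℤ :=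
  (Finset.Ico 0 (2 * (m:ℤ))).filter fun p => sg m τ p = 1

lemma PR_same {m : ℕ} (hm : 0 < m) {τ : Equiv.Perm ℤ} {p p' q : ℤ} (h : PR m τ p q) (h' : PR m τ p' q) :
    p = p' := by
  obtain ⟨h1, X, Y, h2, h3⟩ := h
  obtain ⟨h1', X', Y', h2', h3'⟩ := h'
  rcases h3 with ⟨h3, h4⟩ | ⟨h3, h4⟩ <;> rcases h3' with ⟨h3', h4'⟩ | ⟨h3', h4'⟩
  · have : Y = Y' := by omega
    subst this
    have := Lk_left hm h2 h2'; omega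
  · omega
  · omega
  · have : X = X' := by omega
    subst this
    have := Lk_right hm h2 h2'; omega

def CL (m : ℕ) (τ : Equiv.Perm ℤ) (x q : ℤ) : Prop :=
  ∃ Y, Lk m τ x Y ∧ ((x < Y ∧ q = 2 * Y) ∨ (Y ≤ x ∧ q = 2 * x + 1))

lemma CL_shift {m : ℕ} (hm : 0 < m) {τ : Equiv.Perm ℤ} (hτ : inB (m+1) τ) {x q : ℤ} (k : ℤ)
    (h : CL m τ x q) : CL m τ (x + m * k) (q + 2 * m * k) := by
  obtain ⟨Y, h1, h2⟩ := h
  refine ⟨_, Lk_shift hm hτ k h1, ?_⟩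
  rcases h2 with ⟨h2, rfl⟩ | ⟨h2, rfl⟩
  · left; exact ⟨by omega, by ring⟩
  · right; exact ⟨by omega, by ring⟩

lemma CL_left {m : ℕ} (hm : 0 < m) {τ : Equiv.Perm ℤ} {x x' q : ℤ} (h : CL m τ x q)
    (h' : CL m τ x' q) : x = x' := by
  obtain ⟨Y, h1, h2⟩ := h
  obtain ⟨Y', h1', h2'⟩ := h'
  rcases h2 with ⟨h2, h3⟩ | ⟨h2, h3⟩ <;> rcases h2' with ⟨h2', h3'⟩ | ⟨h2', h3'⟩
  · have : Y = Y' := by omega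
    subst this
    exact Lk_left hm h1 h1'
  all_goals omega

lemma sg_neg_CL {m : ℕ} {τ : Equiv.Perm ℤ} {q : ℤ} : sg m τ q = -1 ↔ ∃ x, CL m τ x q := by
  rw [sg_neg]
  constructor
  · rintro ⟨p, h1, X, Y, h2, h3⟩
    exact ⟨X, Y, h2, by omega⟩
  · rintro ⟨X, Y, h2, h3 | h3⟩
    · exact ⟨2*X+1, by omega, X, Y, h2, by omega⟩
    · exact ⟨2*Y, by omega, X, Y, h2, by omega⟩

lemma card_neg {m : ℕ} (hm : 0 < m) {τ : Equiv.Perm ℤ} (hτ : inB (m+1) τ) :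
    ((Finset.Ico 0 (2 * (m:ℤ))).filter fun p => ¬ sg m τ p = 1).card = m ∨
    ((Finset.Ico 0 (2 * (m:ℤ))).filter fun p => ¬ sg m τ p = 1).card + 1 = m := by
  classical
  have hex : ∀ x, (∃ Y, Lk m τ x Y) → ∃ q, CL m τ x q := by
    rintro x ⟨Y, hY⟩
    by_cases h : x < Y
    · exact ⟨2*Y, Y, hY, Or.inl ⟨h, rfl⟩⟩
    · exact ⟨2*x+1, Y, hY, Or.inr ⟨by omega, rfl⟩⟩
  have hcard : ((Finset.Ico 0 (m:ℤ)).filter fun x => ∃ Y, Lk m τ x Y).card =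
      ((Finset.Ico 0 (2 * (m:ℤ))).filter fun p => ¬ sg m τ p = 1).card := by
    refine Finset.card_bij (fun x hx => (hex x (Finset.mem_filter.1 hx).2).choose % (2 * m)) ?_ ?_ ?_
    · intro x hx
      have hc := (hex x (Finset.mem_filter.1 hx).2).choose_spec
      generalize (hex x (Finset.mem_filter.1 hx).2).choose = q at hc
      rw [Finset.mem_filter, Finset.mem_Ico]
      refine ⟨⟨Int.emod_nonneg _ (by omega), Int.emod_lt_of_pos _ (by omega)⟩, ?_⟩
      have h1 : sg m τ q = -1 := sg_neg_CL.2 ⟨x, hc⟩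
      rw [← Int.emod_add_mul_ediv q (2*m), sg_per hm hτ] at h1
      omega
    · intro x hx x' hx' he
      have hc := (hex x (Finset.mem_filter.1 hx).2).choose_spec
      have hc' := (hex x' (Finset.mem_filter.1 hx').2).choose_spec
      generalize (hex x (Finset.mem_filter.1 hx).2).choose = q at hc he
      generalize (hex x' (Finset.mem_filter.1 hx').2).choose = q' at hc' he
      rw [Finset.mem_filter, Finset.mem_Ico] at hx hx'
      have e1 := Int.emod_add_mul_ediv q (2*m)
      have e2 := Int.emod_add_mul_ediv q' (2*m)
      have e3 : q + 2 * m * (q' / (2*m) - q / (2*m)) = q' := by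
        rw [mul_sub]; omega
      have hs := CL_shift hm hτ (q' / (2*m) - q / (2*m)) hc
      rw [e3] at hs
      have h5 := CL_left hm hs hc'
      have h6 := small_mulZ (M := (m:ℤ)) (k := q' / (2*m) - q / (2*m)) (by omega) (by omega) (by omega)
      rw [h6] at h5
      omega
    · intro q hq
      rw [Finset.mem_filter, Finset.mem_Ico] at hq
      have h1 : sg m τ q = -1 := by rcases sg_pm m τ q with h | h <;> simp_all
      obtain ⟨X, hX⟩ := sg_neg_CL.1 h1
      obtain ⟨r, k, hr, h0, h2⟩ := red1 hm X
      have hC := CL_shift hm hτ (-k) hX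
      rw [show X + m * -k = r by rw [hr]; ring] at hC
      have hr' : r ∈ (Finset.Ico 0 (m:ℤ)).filter fun x => ∃ Y, Lk m τ x Y := by
        rw [Finset.mem_filter, Finset.mem_Ico]
        exact ⟨⟨h0, h2⟩, hC.choose, hC.choose_spec.1⟩
      refine ⟨r, hr', ?_⟩
      have hc := (hex r (Finset.mem_filter.1 hr').2).choose_spec
      generalize (hex r (Finset.mem_filter.1 hr').2).choose = q' at hc
      have : q' = q + 2 * m * -k := by
        obtain ⟨Y, h3, h4⟩ := hc
        obtain ⟨Y', h3', h4'⟩ := hC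
        have := Lk_right hm h3 h3'
        subst this
        omega
      rw [this, Int.add_mul_emod_self_left, Int.emod_eq_of_lt hq.1.1 hq.1.2]
  rw [← hcard]
  have htot := Finset.card_filter_add_card_filter_not (s := Finset.Ico 0 (m:ℤ)) (fun x => ∃ Y, Lk m τ x Y)
  have h1 : ((Finset.Ico 0 (m:ℤ)).filter fun x => ¬ ∃ Y, Lk m τ x Y).card ≤ 1 := by
    rw [Finset.card_le_one]
    have hN : ∀ x, (¬ ∃ Y, Lk m τ x Y) → IsN m (τ (uu m x)) := by
      intro x hx
      rcases signed_cases' (inB_mem hτ (uu_mem' hm x)) with ⟨Y, hY⟩ | h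
      · obtain ⟨Y', -, h⟩ := Lk_of_eq hm hY
        exact absurd ⟨Y', h⟩ hx
      · exact h
    intro x hx y hy
    rw [Finset.mem_filter, Finset.mem_Ico] at hx hy
    apply uu_eq_neg hm _ (by omega) (by omega)
    rcases (hN y hy.2).eq_or (hN x hx.2) with h | h
    · exact Or.inl (τ.injective h)
    · rw [← hτ.1] at h
      exact Or.inr (τ.injective h)
  rw [Int.card_Ico] at htot
  omega

lemma AA_card {m : ℕ} (hm : 0 < m) {τ : Equiv.Perm ℤ} (hτ : inB (m+1) τ) :
    (AA m τ).card = m ∨ (AA m τ).card = m + 1 := by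
  have h1 := card_neg hm hτ
  have htot := Finset.card_filter_add_card_filter_not (s := Finset.Ico 0 (2*(m:ℤ))) (fun p => sg m τ p = 1)
  rw [Int.card_Ico] at htot
  unfold AA
  omega

lemma sg_of_AA {m : ℕ} (hm : 0 < m) {τ σ : Equiv.Perm ℤ} (hτ : inB (m+1) τ) (hσ : inB (m+1) σ)
    (h : AA m τ = AA m σ) : sg m τ = sg m σ := by
  ext p
  obtain ⟨r, k, rfl, h0, h1⟩ := red2 hm p
  rw [sg_per hm hτ, sg_per hm hσ]
  have : r ∈ AA m τ ↔ r ∈ AA m σ := by rw [h]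
  simp only [AA, Finset.mem_filter, Finset.mem_Ico, h0, h1, true_and, and_self] at this
  rcases sg_pm m τ r with h | h <;> rcases sg_pm m σ r with h' | h' <;> simp_all


def NN (m : ℕ) (d c : ℤ) : ℤ := if c % 4 = 1 then d * (m + 1) else -(d * (m + 1))

lemma NN_isN {m : ℕ} {d : ℤ} (hd : d = 1 ∨ d = -1) (c : ℤ) : IsN m (NN m d c) := by
  unfold NN IsN
  rcases hd with rfl | rfl <;> split_ifs <;> simp

lemma NN_mod {m : ℕ} {d c c' : ℤ} (h : c % 4 = c' % 4) : NN m d c = NN m d c' := by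
  unfold NN; rw [h]

lemma NN_two {m : ℕ} {d c : ℤ} (h : c % 2 = 1) : NN m d (c + 2) = - NN m d c := by
  unfold NN
  split_ifs <;> omega

lemma NN_inj {m : ℕ} {d c c' : ℤ} (hd : d = 1 ∨ d = -1) (h : c % 2 = 1) (h' : c' % 2 = 1)
    (he : NN m d c = NN m d c') : c % 4 = c' % 4 := by
  unfold NN at he
  rcases hd with rfl | rfl <;> split_ifs at he <;> omega

lemma NN_exists {m : ℕ} {d N : ℤ} (hd : d = 1 ∨ d = -1) (hN : IsN m N) :
    ∃ c, c % 2 = 1 ∧ NN m d c = N := by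
  rcases hN.eq_or (NN_isN hd 1) with h | h
  · exact ⟨1, rfl, h⟩
  · exact ⟨1 + 2, rfl, by rw [NN_two rfl, h]; ring⟩

lemma NN_neg (m : ℕ) (d c : ℤ) : NN m (-d) c = - NN m d c := by
  unfold NN; split_ifs <;> ring

inductive RR (m : ℕ) (s : ℤ → ℤ) (d : ℤ) (z z' : ℤ) : Prop
  | r1 (X Y : ℤ) (hz : z = uu m X) (hz' : z' = uu m Y) (h : PM s (2*X+1) (2*Y))
  | r2 (X : ℤ) (hz : z = uu m X) (hz' : z' = NN m d (HH s (2*X+1))) (h : UU s (2*X+1))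
  | r3 (v : ℤ) (hz : z = NN m d (HH s (2*v) + 1)) (hz' : z' = uu m v) (h : UU s (2*v))
  | r4 (hz : IsN m z) (hz' : z' = d * z) (h : ∀ p, ¬ UU s p)
  | r5 (hz : z ∉ signedSet (m+1)) (hz' : z' = z)

lemma Per.PMk {m : ℕ} {s : ℤ → ℤ} {S : ℤ} (h : Per m s S) {p q : ℤ} (k : ℤ) (hM : PM s p q) :
    PM s (p + 2 * m * k) (q + 2 * m * k) := hM.imp (h.MMk k) (h.MMk k)

lemma IsN_mul {m : ℕ} {d z : ℤ} (hd : d = 1 ∨ d = -1) (hz : IsN m z) : IsN m (d * z) := by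
  rcases hd with rfl | rfl
  · simpa using hz
  · simpa using hz.neg

lemma Per.mod4 {m : ℕ} {s : ℤ → ℤ} {S : ℤ} (h : Per m s S) (p k : ℤ) :
    HH s (p + 2 * m * (2 * k)) % 4 = HH s p % 4 := by
  rw [h.Hk]
  rcases h.S02 with rfl | rfl <;> omega

section
variable {m : ℕ} {s : ℤ → ℤ} {S d : ℤ}

lemma RR_out (hm : 0 < m) (h : Per m s S) (hd : d = 1 ∨ d = -1) {X z' : ℤ} (hR : RR m s d (uu m X) z') :
    (∃ Y, PM s (2*X+1) (2*Y) ∧ z' = uu m Y) ∨ (UU s (2*X+1) ∧ z' = NN m d (HH s (2*X+1))) := by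
  rcases hR with ⟨X', Y, hz, hz', hP⟩ | ⟨X', hz, hz', hP⟩ | ⟨v, hz, hz', hP⟩ | ⟨hz, hz', hP⟩ | ⟨hz, hz'⟩
  · obtain ⟨k, rfl⟩ := uu_inj hm hz.symm
    left
    refine ⟨Y + 2 * m * k, ?_, by rw [hz', uu_per2]⟩
    have := h.PMk (2*k) hP
    convert this using 1 <;> ring
  · obtain ⟨k, rfl⟩ := uu_inj hm hz.symm
    right
    have := h.UUk (2*k) hP
    have e : 2 * (X' + 2 * m * k) + 1 = 2 * X' + 1 + 2 * m * (2 * k) := by ring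
    rw [e]
    refine ⟨this, ?_⟩
    rw [hz', NN_mod (h.mod4 _ _)]
  · exact absurd hz.symm ((NN_isN hd _).ne_uu hm X)
  · exact absurd rfl (hz.ne_uu hm X)
  · exact absurd (uu_mem' hm X) hz

lemma RR_in (hm : 0 < m) (h : Per m s S) (hd : d = 1 ∨ d = -1) {z v : ℤ} (hR : RR m s d z (uu m v)) :
    (∃ X, PM s (2*X+1) (2*v) ∧ z = uu m X) ∨ (UU s (2*v) ∧ z = NN m d (HH s (2*v) + 1)) := by
  rcases hR with ⟨X', Y, hz, hz', hP⟩ | ⟨X', hz, hz', hP⟩ | ⟨v', hz, hz', hP⟩ | ⟨hz, hz', hP⟩ | ⟨hz, hz'⟩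
  · obtain ⟨k, rfl⟩ := uu_inj hm hz'.symm
    left
    refine ⟨X' + 2 * m * k, ?_, by rw [hz, uu_per2]⟩
    have := h.PMk (2*k) hP
    convert this using 1 <;> ring
  · exact absurd hz'.symm ((NN_isN hd _).ne_uu hm v)
  · obtain ⟨k, rfl⟩ := uu_inj hm hz'.symm
    right
    have := h.UUk (2*k) hP
    have e : 2 * (v' + 2 * m * k) = 2 * v' + 2 * m * (2 * k) := by ring
    rw [e]
    refine ⟨this, ?_⟩
    have := h.mod4 (2*v') k
    rw [hz]
    exact NN_mod (by omega)
  · exact absurd hz'.symm ((IsN_mul hd hz).ne_uu hm v)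
  · rw [← hz'] at hz
    exact absurd (uu_mem' hm v) hz

lemma RR_Nout (hm : 0 < m) {z z' : ℤ} (hN : IsN m z) (hR : RR m s d z z') :
    (∃ v, UU s (2*v) ∧ z = NN m d (HH s (2*v) + 1) ∧ z' = uu m v) ∨ ((∀ p, ¬ UU s p) ∧ z' = d * z) := by
  rcases hR with ⟨X', Y, hz, hz', hP⟩ | ⟨X', hz, hz', hP⟩ | ⟨v', hz, hz', hP⟩ | ⟨hz, hz', hP⟩ | ⟨hz, hz'⟩
  · exact absurd hz (hN.ne_uu hm _)
  · exact absurd hz (hN.ne_uu hm _)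
  · exact Or.inl ⟨v', hP, hz, hz'⟩
  · exact Or.inr ⟨hP, hz'⟩
  · exact absurd hN.mem hz

lemma RR_Nin (hm : 0 < m) {z z' : ℤ} (hN : IsN m z') (hR : RR m s d z z') :
    (∃ X, UU s (2*X+1) ∧ z' = NN m d (HH s (2*X+1)) ∧ z = uu m X) ∨ ((∀ p, ¬ UU s p) ∧ z' = d * z) := by
  rcases hR with ⟨X', Y, hz, hz', hP⟩ | ⟨X', hz, hz', hP⟩ | ⟨v', hz, hz', hP⟩ | ⟨hz, hz', hP⟩ | ⟨hz, hz'⟩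
  · exact absurd hz' (hN.ne_uu hm _)
  · exact Or.inl ⟨X', hP, hz', hz⟩
  · exact absurd hz' (hN.ne_uu hm _)
  · exact Or.inr ⟨hP, hz'⟩
  · rw [← hz'] at hz
    exact absurd hN.mem hz

lemma RR_mem (hm : 0 < m) (hd : d = 1 ∨ d = -1) {z z' : ℤ} (hR : RR m s d z z') :
    (z ∈ signedSet (m+1) ∧ z' ∈ signedSet (m+1)) ∨ (z ∉ signedSet (m+1) ∧ z' = z) := by
  rcases hR with ⟨X', Y, hz, hz', hP⟩ | ⟨X', hz, hz', hP⟩ | ⟨v', hz, hz', hP⟩ | ⟨hz, hz', hP⟩ | ⟨hz, hz'⟩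
  · rw [hz, hz']; exact Or.inl ⟨uu_mem' hm _, uu_mem' hm _⟩
  · rw [hz, hz']; exact Or.inl ⟨uu_mem' hm _, (NN_isN hd _).mem⟩
  · rw [hz, hz']; exact Or.inl ⟨(NN_isN hd _).mem, uu_mem' hm _⟩
  · rw [hz']; exact Or.inl ⟨hz.mem, (IsN_mul hd hz).mem⟩
  · exact Or.inr ⟨hz, hz'⟩

lemma RR_fun (hm : 0 < m) (h : Per m s S) (hd : d = 1 ∨ d = -1) {z z1 z2 : ℤ} (h1 : RR m s d z z1)
    (h2 : RR m s d z z2) : z1 = z2 := by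
  rcases RR_mem hm hd h1 with ⟨hz, -⟩ | ⟨hz, e1⟩
  · rcases signed_cases' hz with ⟨X, rfl⟩ | hN
    · rcases RR_out hm h hd h1 with ⟨Y, a, b⟩ | ⟨a, b⟩ <;>
        rcases RR_out hm h hd h2 with ⟨Y', a', b'⟩ | ⟨a', b'⟩
      · have := PM_unique h.pm a a'
        have : Y = Y' := by omega
        rw [b, b', this]
      · exact absurd a' (PM_not_UU a)
      · exact absurd a (PM_not_UU a')
      · rw [b, b']
    · rcases RR_Nout hm hN h1 with ⟨Y, a, b, c⟩ | ⟨a, b⟩ <;>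
        rcases RR_Nout hm hN h2 with ⟨Y', a', b', c'⟩ | ⟨a', b'⟩
      · have hp := HH_parity h.pm (2*Y)
        have hp' := HH_parity h.pm (2*Y')
        have hS := h.U_S hm a
        subst hS
        have h4 := NN_inj hd (by omega) (by omega) (b.symm.trans b')
        obtain ⟨k, hk⟩ : ∃ k, HH s (2*Y') = HH s (2*Y) + 2 * (2 * k) :=
          ⟨(HH s (2*Y') - HH s (2*Y)) / 4, by omega⟩
        have h5 := h.Hk (2*Y) (2*k)
        have := U_inj a' (h.UUk (2*k) a) (by rw [h5, hk])
        have : Y' = Y + 2 * m * k := by linarith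
        rw [c, c', this, uu_per2]
      · exact absurd a (a' _)
      · exact absurd a' (a _)
      · rw [b, b']
  · rcases RR_mem hm hd h2 with ⟨hz', -⟩ | ⟨hz, e2⟩
    · exact absurd hz' hz
    · rw [e1, e2]

lemma RR_inj (hm : 0 < m) (h : Per m s S) (hd : d = 1 ∨ d = -1) {z z1 z2 : ℤ} (h1 : RR m s d z1 z)
    (h2 : RR m s d z2 z) : z1 = z2 := by
  rcases RR_mem hm hd h1 with ⟨-, hz⟩ | ⟨hz, e1⟩
  · rcases signed_cases' hz with ⟨X, rfl⟩ | hN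
    · rcases RR_in hm h hd h1 with ⟨Y, a, b⟩ | ⟨a, b⟩ <;>
        rcases RR_in hm h hd h2 with ⟨Y', a', b'⟩ | ⟨a', b'⟩
      · have := PM_unique h.pm a.symm a'.symm
        have : Y = Y' := by omega
        rw [b, b', this]
      · exact absurd a' (PM_not_UU a.symm)
      · exact absurd a (PM_not_UU a'.symm)
      · rw [b, b']
    · rcases RR_Nin hm hN h1 with ⟨Y, a, b, c⟩ | ⟨a, b⟩ <;>
        rcases RR_Nin hm hN h2 with ⟨Y', a', b', c'⟩ | ⟨a', b'⟩
      · have hp := HH_parity h.pm (2*Y+1)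
        have hp' := HH_parity h.pm (2*Y'+1)
        have hS := h.U_S hm a
        subst hS
        have h4 := NN_inj hd (by omega) (by omega) (b.symm.trans b')
        obtain ⟨k, hk⟩ : ∃ k, HH s (2*Y'+1) = HH s (2*Y+1) + 2 * (2 * k) :=
          ⟨(HH s (2*Y'+1) - HH s (2*Y+1)) / 4, by omega⟩
        have h5 := h.Hk (2*Y+1) (2*k)
        have := U_inj a' (h.UUk (2*k) a) (by rw [h5, hk])
        have : Y' = Y + 2 * m * k := by linarith
        rw [c, c', this, uu_per2]
      · exact absurd a (a' _)
      · exact absurd a' (a _)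
      · rw [b] at b'
        rcases hd with rfl | rfl <;> omega
  · rcases RR_mem hm hd h2 with ⟨hz2, hz'⟩ | ⟨hz2, e2⟩
    · rw [e1] at hz'; exact absurd hz' hz
    · rw [← e1, ← e2]

lemma RR_total (hm : 0 < m) (h : Per m s S) (hd : d = 1 ∨ d = -1) (z : ℤ) : ∃ z', RR m s d z z' := by
  by_cases hz : z ∈ signedSet (m+1)
  · rcases signed_cases' hz with ⟨X, rfl⟩ | hN
    · rcases h.tri hm (2*X+1) with ⟨q, hq⟩ | hU
      · have : (q - (2*X+1)) % 2 = 1 := by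
          rcases hq with hq | hq <;> have := MM_parity h.pm hq <;> omega
        obtain ⟨Y, rfl⟩ : ∃ Y, q = 2 * Y := ⟨q/2, by omega⟩
        exact ⟨_, .r1 X Y rfl rfl hq⟩
      · exact ⟨_, .r2 X rfl rfl hU⟩
    · by_cases hU : ∃ p, UU s p
      · obtain ⟨p, hp⟩ := hU
        have hS := h.U_S hm hp
        subst hS
        obtain ⟨c, hc, rfl⟩ := NN_exists hd hN
        obtain ⟨q, hq1, hq2⟩ := h.U_exists hm (c - 1)
        have := HH_parity h.pm q
        obtain ⟨Y, rfl⟩ : ∃ Y, q = 2 * Y := ⟨q/2, by omega⟩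
        exact ⟨_, .r3 Y (by rw [hq2]; ring_nf) rfl hq1⟩
      · push Not at hU
        exact ⟨_, .r4 hN rfl hU⟩
  · exact ⟨_, .r5 hz rfl⟩

lemma RR_surj (hm : 0 < m) (h : Per m s S) (hd : d = 1 ∨ d = -1) (z' : ℤ) : ∃ z, RR m s d z z' := by
  by_cases hz : z' ∈ signedSet (m+1)
  · rcases signed_cases' hz with ⟨Y, rfl⟩ | hN
    · rcases h.tri hm (2*Y) with ⟨q, hq⟩ | hU
      · have : (q - (2*Y)) % 2 = 1 := by
          rcases hq with hq | hq <;> have := MM_parity h.pm hq <;> omega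
        obtain ⟨X, rfl⟩ : ∃ X, q = 2 * X + 1 := ⟨q/2, by omega⟩
        exact ⟨_, .r1 X Y rfl rfl hq.symm⟩
      · exact ⟨_, .r3 Y rfl rfl hU⟩
    · by_cases hU : ∃ p, UU s p
      · obtain ⟨p, hp⟩ := hU
        have hS := h.U_S hm hp
        subst hS
        obtain ⟨c, hc, rfl⟩ := NN_exists hd hN
        obtain ⟨q, hq1, hq2⟩ := h.U_exists hm c
        have := HH_parity h.pm q
        obtain ⟨Y, rfl⟩ : ∃ Y, q = 2 * Y + 1 := ⟨q/2, by omega⟩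
        exact ⟨_, .r2 Y rfl (by rw [hq2]) hq1⟩
      · push Not at hU
        refine ⟨d * z', .r4 (IsN_mul hd hN) ?_ hU⟩
        rcases hd with rfl | rfl <;> ring
  · exact ⟨_, .r5 hz rfl⟩

lemma RR_neg (hm : 0 < m) (h : Per m s S) {z z' : ℤ} (hR : RR m s d z z') :
    RR m s d (-z) (-z') := by
  rcases hR with ⟨X, Y, hz, hz', hP⟩ | ⟨X, hz, hz', hP⟩ | ⟨v, hz, hz', hP⟩ | ⟨hz, hz', hP⟩ | ⟨hz, hz'⟩
  · refine .r1 (X + m) (Y + m) (by rw [uu_neg hm, hz]) (by rw [uu_neg hm, hz']) ?_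
    have := h.PMk 1 hP
    convert this using 1 <;> ring
  · have hS := h.U_S hm hP
    subst hS
    have e : 2 * (X + m) + 1 = 2 * X + 1 + 2 * m * 1 := by ring
    have hp := HH_parity h.pm (2*X+1)
    refine .r2 (X + m) (by rw [uu_neg hm, hz]) ?_ ?_
    · rw [e, h.Hk, mul_one, NN_two (by omega), hz']
    · rw [e]; exact h.UUk 1 hP
  · have hS := h.U_S hm hP
    subst hS
    have e : 2 * (v + m) = 2 * v + 2 * m * 1 := by ring
    have hp := HH_parity h.pm (2*v)
    refine .r3 (v + m) ?_ (by rw [uu_neg hm, hz']) ?_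
    · rw [e, h.Hk, mul_one, add_right_comm, NN_two (by omega), hz]
    · rw [e]; exact h.UUk 1 hP
  · exact .r4 hz.neg (by rw [hz']; ring) hP
  · refine .r5 ?_ (by rw [hz'])
    rw [mem_signedSet] at *; omega

lemma RR_perm (hm : 0 < m) (h : Per m s S) (hd : d = 1 ∨ d = -1) :
    ∃ τ : Equiv.Perm ℤ, ∀ z z', τ z = z' ↔ RR m s d z z' := by
  choose f hf using RR_total hm h hd
  have hb : Function.Bijective f := by
    constructor
    · intro x y hxy
      have := hf y
      rw [← hxy] at this
      exact RR_inj hm h hd (hf x) this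
    · intro z'
      obtain ⟨z, hz⟩ := RR_surj hm h hd z'
      exact ⟨z, RR_fun hm h hd (hf z) hz⟩
  refine ⟨Equiv.ofBijective f hb, fun z z' => ⟨?_, fun hR => RR_fun hm h hd (hf z) hR⟩⟩
  rintro rfl
  exact hf z

end


section
variable {m : ℕ} {s : ℤ → ℤ} {S d : ℤ}

lemma PM_window (hm : 0 < m) (h : Per m s S) {X Y : ℤ} (hP : PM s (2*X+1) (2*Y)) :
    X - m < Y ∧ Y ≤ X + m := by
  rcases hP with hP | hP
  · have := h.span hm hP; have := hP.1; omega
  · have := h.span hm hP; have := hP.1; omega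

lemma lk_iff (hm : 0 < m) (h : Per m s S) (hd : d = 1 ∨ d = -1) {τ : Equiv.Perm ℤ}
    (hτ : ∀ z z', τ z = z' ↔ RR m s d z z') (X Y : ℤ) : Lk m τ X Y ↔ PM s (2*X+1) (2*Y) := by
  constructor
  · rintro ⟨h1, h2, h3⟩
    rcases RR_out hm h hd ((hτ _ _).1 h1) with ⟨Y', a, b⟩ | ⟨a, b⟩
    · have := PM_window hm h a
      have := uu_inj_lt hm b (by omega) (by omega)
      rwa [this]
    · exact absurd b.symm ((NN_isN hd _).ne_uu hm Y)
  · intro hP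
    have := PM_window hm h hP
    exact ⟨(hτ _ _).2 (.r1 X Y rfl rfl hP), this.1, this.2⟩

lemma tau_inB (hm : 0 < m) (h : Per m s S) {τ : Equiv.Perm ℤ}
    (hτ : ∀ z z', τ z = z' ↔ RR m s d z z') : inB (m+1) τ := by
  refine ⟨fun x => (hτ _ _).2 (RR_neg hm h ((hτ _ _).1 rfl)), fun x hx => (hτ _ _).2 (.r5 hx rfl)⟩

/-- an odd position is matched to an even one -/
lemma tri_odd (hm : 0 < m) (h : Per m s S) (X : ℤ) : (∃ Y, PM s (2*X+1) (2*Y)) ∨ UU s (2*X+1) := by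
  rcases h.tri hm (2*X+1) with ⟨q, hq⟩ | hU
  · have : (q - (2*X+1)) % 2 = 1 := by
      rcases hq with hq | hq <;> have := MM_parity h.pm hq <;> omega
    obtain ⟨Y, rfl⟩ : ∃ Y, q = 2 * Y := ⟨q/2, by omega⟩
    exact Or.inl ⟨Y, hq⟩
  · exact Or.inr hU

lemma tau_nonc (hm : 0 < m) (h : Per m s S) (hd : d = 1 ∨ d = -1) {τ : Equiv.Perm ℤ}
    (hτ : ∀ z z', τ z = z' ↔ RR m s d z z') : Nonc m τ where
  inb := tau_inB hm h hτ
  fwd := by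
    intro X Y h1 h2 h3 j h4 h5
    have hP := (lk_iff hm h hd hτ X Y).1 ⟨h1, by omega, h3⟩
    rcases hP with hP | hP
    · obtain ⟨r', h6, h7, h8⟩ := h.inside hm hP (r := 2*j+1) (by omega) (by omega)
      rcases tri_odd hm h j with ⟨Y', hY'⟩ | hU
      · have := PM_unique h.pm h8 hY'
        subst this
        exact ⟨Y', by omega, by omega, ((lk_iff hm h hd hτ j Y').2 hY').1⟩
      · exact absurd hU (PM_not_UU h8)
    · have := hP.1; omega
  bwd := by
    intro X Y h1 h2 h3 j h4 h5
    have hP := (lk_iff hm h hd hτ X Y).1 ⟨h1, by omega, by omega⟩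
    rcases eq_or_lt_of_le h5 with rfl | h5
    · exact ⟨Y, le_rfl, h2, h1⟩
    rcases hP with hP | hP
    · have := hP.1; omega
    · obtain ⟨r', h6, h7, h8⟩ := h.inside hm hP (r := 2*j+1) (by omega) (by omega)
      rcases tri_odd hm h j with ⟨Y', hY'⟩ | hU
      · have := PM_unique h.pm h8 hY'
        subst this
        exact ⟨Y', by omega, by omega, ((lk_iff hm h hd hτ j Y').2 hY').1⟩
      · exact absurd hU (PM_not_UU h8)
  out := by
    intro X N hN h1 j h2 h3
    rcases RR_out hm h hd ((hτ _ _).1 h1) with ⟨Y', a, b⟩ | ⟨a, b⟩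
    · exact absurd b (hN.ne_uu hm _)
    rcases eq_or_lt_of_le h3 with rfl | h3
    · exact Or.inl h1
    right
    have hS := h.U_S hm a
    subst hS
    have a' := h.UUk (-1) a
    have e := h.Hk (2*X+1) (-1)
    rcases tri_odd hm h j with ⟨Y', hY'⟩ | hU
    · refine ⟨Y', ?_, ?_, ((lk_iff hm h hd hτ j Y').2 hY').1⟩
      · have := PM_UU_gt hY' a' (by linarith); omega
      · have := PM_UU_lt hY' a (by omega); omega
    · exfalso
      have p1 := HH_parity h.pm (2*X+1)
      have p2 := HH_parity h.pm (2*j+1)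
      have b1 := hU (2*X+1) (by omega)
      have b2 := a' (2*j+1) (by linarith)
      omega
  out' := by
    intro X N hN h1
    rcases RR_out hm h hd ((hτ _ _).1 h1) with ⟨Y', a, b⟩ | ⟨a, b⟩
    · exact absurd b (hN.ne_uu hm _)
    have hS := h.U_S hm a
    subst hS
    have a' := h.UUk (-1) a
    have e := h.Hk (2*X+1) (-1)
    obtain ⟨q, hq1, hq2⟩ := h.U_exists hm (HH s (2*X+1) - 1)
    have p1 := HH_parity h.pm (2*X+1)
    have p2 := HH_parity h.pm q
    obtain ⟨v, rfl⟩ : ∃ v, q = 2 * v := ⟨q/2, by omega⟩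
    have l1 := U_mono a (by omega) (p := 2 * v)
    have l2 := U_mono hq1 (by omega) (p := 2*X+1+2*m*(-1))
    refine ⟨v, by omega, by omega, (hτ _ _).2 (.r3 v ?_ rfl hq1)⟩
    rw [b, hq2]; congr 1; ring
  inn := by
    intro v N hN h1 j h2 h3
    rcases RR_in hm h hd ((hτ _ _).1 h1) with ⟨Y', a, b⟩ | ⟨a, b⟩
    · exact absurd b (hN.ne_uu hm _)
    have hS := h.U_S hm a
    subst hS
    have a' := h.UUk 1 a
    have e := h.Hk (2*v) 1
    rcases tri_odd hm h j with ⟨Y', hY'⟩ | hU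
    · right
      refine ⟨Y', ?_, ?_, ((lk_iff hm h hd hτ j Y').2 hY').1⟩
      · have := PM_UU_gt hY' a (by omega); omega
      · have := PM_UU_lt hY' a' (by omega); omega
    · left
      have p1 := HH_parity h.pm (2*v)
      have p2 := HH_parity h.pm (2*j+1)
      have b1 := hU (2*v+2*m*1) (by omega)
      have b2 := a (2*j+1) (by omega)
      have : HH s (2*j+1) = HH s (2*v) + 1 := by omega
      rw [b, ← this]
      exact (hτ _ _).2 (.r2 j rfl rfl hU)

lemma tau_sg (hm : 0 < m) (h : Per m s S) (hd : d = 1 ∨ d = -1) {τ : Equiv.Perm ℤ}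
    (hτ : ∀ z z', τ z = z' ↔ RR m s d z z') : sg m τ = s := by
  ext q
  have key : (sg m τ q = -1) ↔ s q = -1 := by
    rw [sg_neg]
    constructor
    · rintro ⟨p, h1, X, Y, h2, h3⟩
      rw [lk_iff hm h hd hτ] at h2
      have : PM s p q := by
        rcases h3 with ⟨rfl, rfl⟩ | ⟨rfl, rfl⟩
        · exact h2
        · exact h2.symm
      rcases this with this | this
      · exact MM_right h.pm this
      · have := this.1; omega
    · intro hq
      obtain ⟨p, hp⟩ := h.closer hm hq
      have hpar := MM_parity h.pm hp
      refine ⟨p, hp.1, ?_⟩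
      rcases Int.even_or_odd' p with ⟨Y, rfl | rfl⟩
      · obtain ⟨X, rfl⟩ : ∃ X, q = 2 * X + 1 := ⟨q/2, by omega⟩
        exact ⟨X, Y, (lk_iff hm h hd hτ X Y).2 (Or.inr hp), Or.inr ⟨rfl, rfl⟩⟩
      · obtain ⟨X, rfl⟩ : ∃ X, q = 2 * X := ⟨q/2, by omega⟩
        exact ⟨Y, X, (lk_iff hm h hd hτ Y X).2 (Or.inl hp), Or.inl ⟨rfl, rfl⟩⟩
  rcases sg_pm m τ q with h1 | h1 <;> rcases h.pm q with h2 | h2 <;> omega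

lemma RR_flip (hm : 0 < m) (h : Per m s S) {N z' : ℤ} (hN : IsN m N) (hR : RR m s d N z') :
    RR m s (-d) N (-z') := by
  rcases RR_Nout hm hN hR with ⟨v, a, b, c⟩ | ⟨a, b⟩
  · have : RR m s (-d) (-N) z' := .r3 v (by rw [NN_neg, b]) c a
    have := RR_neg hm h this
    rwa [neg_neg] at this
  · exact .r4 hN (by rw [b]; ring) a

lemma exists_tau (hm : 0 < m) (h : Per m s S) (e : Bool) :
    ∃ τ, Nonc m τ ∧ sg m τ = s ∧ decide (0 < τ ((m:ℤ)+1)) = e := by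
  obtain ⟨τ, hτ⟩ := RR_perm hm h (d := 1) (Or.inl rfl)
  obtain ⟨σ, hσ⟩ := RR_perm hm h (d := -1) (Or.inr rfl)
  have htop : IsN m ((m:ℤ)+1) := Or.inl rfl
  have hflip : σ ((m:ℤ)+1) = - τ ((m:ℤ)+1) := (hσ _ _).2 (RR_flip hm h htop ((hτ _ _).1 rfl))
  have h0 := (mem_signedSet.1 (inB_mem (tau_inB hm h hτ) htop.mem)).1
  by_cases hc : decide (0 < τ ((m:ℤ)+1)) = e
  · exact ⟨τ, tau_nonc hm h (Or.inl rfl) hτ, tau_sg hm h (Or.inl rfl) hτ, hc⟩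
  · refine ⟨σ, tau_nonc hm h (Or.inr rfl) hσ, tau_sg hm h (Or.inr rfl) hσ, ?_⟩
    rw [hflip]
    by_cases h1 : 0 < τ ((m:ℤ)+1)
    · have h2 : ¬ (0 < - τ ((m:ℤ)+1)) := by omega
      simp only [h1, h2, decide_true, decide_false] at hc ⊢
      cases e <;> simp_all
    · have h2 : (0 < - τ ((m:ℤ)+1)) := by omega
      simp only [h1, h2, decide_true, decide_false] at hc ⊢
      cases e <;> simp_all

end

open Classical in
noncomputable def sA (m : ℕ) (A : Finset ℤ) (p : ℤ) : ℤ := if p % (2 * (m:ℤ)) ∈ A then 1 else -1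

lemma sA_per {m : ℕ} {A : Finset ℤ} (hA : A ⊆ Finset.Ico 0 (2 * (m:ℤ)))
    (hc : A.card = m ∨ A.card = m + 1) : ∃ S, Per m (sA m A) S := by
  classical
  refine ⟨_, ⟨fun p => ?_, fun p => ?_, rfl, ?_⟩⟩
  · unfold sA; split_ifs <;> simp
  · unfold sA; rw [Int.add_emod_right]
  · unfold HH
    rw [Finset.Ico_eq_empty (a := 2 * (m:ℤ)) (by omega), Finset.sum_empty, sub_zero]
    have : ∑ i ∈ Finset.Ico 0 (2 * (m:ℤ)), sA m A i =
        ∑ i ∈ Finset.Ico 0 (2 * (m:ℤ)), (2 * (if i ∈ A then 1 else 0) - 1) := by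
      apply Finset.sum_congr rfl
      intro i hi
      rw [Finset.mem_Ico] at hi
      unfold sA
      rw [Int.emod_eq_of_lt hi.1 hi.2]
      split_ifs <;> simp
    rw [this, Finset.sum_sub_distrib, ← Finset.mul_sum, Finset.sum_ite_mem,
      Finset.inter_eq_right.2 hA]
    simp
    omega

noncomputable def Phi (m : ℕ) (τ : Equiv.Perm ℤ) : Finset ℤ × Bool := (AA m τ, decide (0 < τ ((m:ℤ)+1)))

noncomputable def DD (m : ℕ) : Finset (Finset ℤ × Bool) :=
  (Finset.powersetCard m (Finset.Ico 0 (2 * (m:ℤ))) ∪ Finset.powersetCard (m+1) (Finset.Ico 0 (2 * (m:ℤ))))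
    ×ˢ Finset.univ

lemma DD_card (m : ℕ) : (DD m).card = Nat.choose (2 * (m+1)) (m+1) := by
  unfold DD
  rw [Finset.card_product, Finset.card_union_of_disjoint, Finset.card_powersetCard,
    Finset.card_powersetCard, Int.card_Ico]
  · have h1 : (2 * (m:ℤ) - 0).toNat = 2 * m := by omega
    rw [h1, ← Nat.choose_succ_succ, show 2 * (m+1) = (2 * m + 1) + 1 by ring,
      Nat.choose_succ_succ (2*m+1) m]
    have : Nat.choose (2*m+1) m = Nat.choose (2*m+1) (m+1) := by
      rw [Nat.choose_symm_half]
    simp only [Nat.succ_eq_add_one, this, Finset.card_univ, Fintype.card_bool]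
    ring
  · rw [Finset.disjoint_left]
    intro A h1 h2
    rw [Finset.mem_powersetCard] at h1 h2
    omega

lemma SncB_nonc {m : ℕ} (hm : 0 < m) {τ : Equiv.Perm ℤ} : τ ∈ SncB m 1 ↔ Nonc m τ :=
  ⟨fun h => nonc_of_snc hm h.1 h.2, fun h => ⟨h.inb, snc_of_nonc hm h⟩⟩

lemma Phi_image {m : ℕ} (hm : 0 < m) : Phi m '' SncB m 1 = (DD m : Set (Finset ℤ × Bool)) := by
  ext ⟨A, e⟩
  simp only [Set.mem_image, DD, Finset.coe_product, Set.mem_prod, Finset.mem_coe, Finset.mem_union,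
    Finset.mem_powersetCard, Finset.mem_univ, and_true]
  constructor
  · rintro ⟨τ, hτ, he⟩
    rw [SncB_nonc hm] at hτ
    simp only [Phi, Prod.mk.injEq] at he
    rw [← he.1]
    have hs : AA m τ ⊆ Finset.Ico 0 (2 * (m:ℤ)) := Finset.filter_subset _ _
    rcases AA_card hm hτ.inb with h | h
    · exact Or.inl ⟨hs, h⟩
    · exact Or.inr ⟨hs, h⟩
  · intro h
    have hA : A ⊆ Finset.Ico 0 (2 * (m:ℤ)) := by rcases h with h | h <;> exact h.1
    obtain ⟨S, hS⟩ := sA_per hA (h.imp And.right And.right)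
    obtain ⟨τ, h1, h2, h3⟩ := exists_tau hm hS e
    refine ⟨τ, (SncB_nonc hm).2 h1, ?_⟩
    simp only [Phi, Prod.mk.injEq]
    refine ⟨?_, h3⟩
    ext p
    rw [AA, Finset.mem_filter, h2, Finset.mem_Ico]
    constructor
    · rintro ⟨h4, h5⟩
      unfold sA at h5
      rw [Int.emod_eq_of_lt h4.1 h4.2] at h5
      by_contra hc
      simp [hc] at h5
    · intro hp
      have h4 := Finset.mem_Ico.1 (hA hp)
      refine ⟨h4, ?_⟩
      unfold sA
      rw [Int.emod_eq_of_lt h4.1 h4.2]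
      simp [hp]

lemma SncB_ncard {m : ℕ} (hm : 0 < m) : (SncB m 1).ncard = Nat.choose (2 * (m+1)) (m+1) := by
  rw [← DD_card, ← Set.ncard_coe_finset, ← Phi_image hm, Set.ncard_image_of_injOn]
  intro τ hτ σ hσ h
  rw [SncB_nonc hm] at hτ hσ
  simp only [Phi, Prod.mk.injEq, decide_eq_decide] at h
  exact phi_inj hm hτ hσ (sg_of_AA hm hτ.inb hσ.inb h.1) h.2

lemma NCB_ncard {m : ℕ} (hm : 0 < m) : (NCB m 1).ncard = Nat.choose (2 * (m+1)) (m+1) := by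
  rw [← SncB_ncard hm]
  have : NCB m 1 = omegaTilde (m+1) '' SncB m 1 := by
    ext A
    simp only [NCB, Set.mem_image, Set.mem_setOf_eq]
    constructor <;> rintro ⟨τ, h1, h2⟩ <;> exact ⟨τ, h1, h2.symm⟩
  rw [this, Set.ncard_image_of_injOn]
  intro τ hτ σ hσ h
  exact omega_inj hτ.1 hσ.1 (gamma_inB hm) (gamma_fixS hm) hτ.2 hσ.2 h

/-- For every integer `n ≥ 2`, the total number of partitions in
`NC^B(n-1,1)` equals the central binomial coefficient `C(2n, n)`. -/
theorem ncb_nm1_1_card (n : ℕ) (hn : 2 ≤ n) :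
    (NCB (n - 1) 1).ncard = Nat.choose (2 * n) n := by
  obtain ⟨m, rfl⟩ : ∃ m, n = m + 1 := ⟨n - 1, by omega⟩
  rw [Nat.add_sub_cancel]
  exact NCB_ncard (by omega)
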